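/- arXiv:1703.04167 — 2 statements merged into one kernel-verified Lean document; each statement's English description precedes it below -/
import Mathlib

section
/- Let R = ℤ[u,v,w,x,y,z] and I = (Δ1, Δ2, Δ3) the ideal of size-2 minors of the generic 2×3 matrix. For every prime integer p, multiplication by p on the local cohomology module H³_I(R) is surjective; that is, H³_I(R) is a divisible abelian group. -/
section Helpers
open CategoryTheory Opposite Limits

section Bridge
universe u v w
variable {R : Type v} [CommRing R] {C : Type u} [Category.{v} C] [Abelian C] [Linear R C]

/-- The functor `Hom(-, Y)`, with values in the opposite category of modules. -/
noncomputable abbrev homOp (R : Type v) [CommRing R] [Linear R C] (Y : C) :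
    C ⥤ (ModuleCat.{v} R)ᵒᵖ :=
  ((linearYoneda R C).obj Y).rightOp

/-- The morphism to `op R` picking the element `f`. -/
noncomputable def pick (R : Type v) [CommRing R] [Linear R C] {A Y : C} (f : A ⟶ Y) :
    (homOp R Y).obj A ⟶ op (ModuleCat.of R R) :=
  Quiver.Hom.op (X := ModuleCat.of R R) (Y := ModuleCat.of R (A ⟶ Y))
    (ModuleCat.ofHom (LinearMap.toSpanSingleton R (A ⟶ Y) f))

lemma pick_surj {A Y : C} (m : (homOp R Y).obj A ⟶ op (ModuleCat.of R R)) :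
    ∃ f : A ⟶ Y, pick R f = m := by
  refine ⟨(show ModuleCat.of R R ⟶ ModuleCat.of R (A ⟶ Y) from m.unop).hom (1 : R), ?_⟩
  apply Quiver.Hom.unop_inj
  refine ModuleCat.hom_ext (LinearMap.ext_ring ?_)
  exact one_smul _ _

lemma pick_inj {A Y : C} {f g : A ⟶ Y} (h : pick R f = pick R g) : f = g := by
  have h1 := congrArg (fun m => (show ModuleCat.of R R ⟶ ModuleCat.of R (A ⟶ Y) from
    Quiver.Hom.unop m).hom (1 : R)) h
  have e : ∀ k : A ⟶ Y, (LinearMap.toSpanSingleton R (A ⟶ Y) k) 1 = k := fun k => one_smul _ _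
  exact (e f).symm.trans (h1.trans (e g))

lemma map_pick {A B Y : C} (φ : A ⟶ B) (f : B ⟶ Y) :
    (homOp R Y).map φ ≫ pick R f = pick R (φ ≫ f) := by
  apply Quiver.Hom.unop_inj
  refine ModuleCat.hom_ext (LinearMap.ext_ring ?_)
  change φ ≫ ((1 : R) • f) = (1 : R) • (φ ≫ f)
  simp

lemma pick_add {A Y : C} (f g : A ⟶ Y) : pick R (f + g) = pick R f + pick R g := by
  apply Quiver.Hom.unop_inj
  refine ModuleCat.hom_ext (LinearMap.ext_ring ?_)
  change (1 : R) • (f + g) = (1 : R) • f + (1 : R) • g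
  simp

/-- additive version -/
noncomputable def pickHom (R : Type v) [CommRing R] [Linear R C] (A Y : C) :
    (A ⟶ Y) →+ ((homOp R Y).obj A ⟶ op (ModuleCat.of R R)) :=
  AddMonoidHom.mk' (pick R) pick_add

lemma nsmul_extMk [HasExt.{w} C] {X Y : C} (P : ProjectiveResolution X) {n : ℕ}
    (f : P.complex.X n ⟶ Y) (hf : P.complex.d (n+1) n ≫ f = 0) (p : ℕ) :
    p • P.extMk f (n+1) rfl hf = P.extMk (p • f) (n+1) rfl (by simp [hf]) := by
  induction p with
  | zero => simp
  | succ p ih => simp only [succ_nsmul, ih, ProjectiveResolution.add_extMk]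

lemma bridge [EnoughProjectives C] [HasExt.{w} C] {X X' Y : C} (g : X' ⟶ X) (p n : ℕ)
    (H : ∀ a : Abelian.Ext.{w} X Y (n+1), ∃ c : Abelian.Ext.{w} X' Y (n+1),
      (Abelian.Ext.mk₀ g).comp a (zero_add _) = p • c)
    (α : ((homOp R Y).leftDerived (n+1)).obj X ⟶ op (ModuleCat.of R R)) :
    ∃ γ : ((homOp R Y).leftDerived (n+1)).obj X' ⟶ op (ModuleCat.of R R),
      ((homOp R Y).leftDerived (n+1)).map g ≫ α = p • γ := by
  let P := projectiveResolution X
  let P' := projectiveResolution X'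
  let K := ((homOp R Y).mapHomologicalComplex (ComplexShape.down ℕ)).obj P.complex
  let K' := ((homOp R Y).mapHomologicalComplex (ComplexShape.down ℕ)).obj P'.complex
  let iso : ((homOp R Y).leftDerived (n+1)).obj X ≅ K.homology (n+1) :=
    P.isoLeftDerivedObj (homOp R Y) (n+1)
  let iso' : ((homOp R Y).leftDerived (n+1)).obj X' ≅ K'.homology (n+1) :=
    P'.isoLeftDerivedObj (homOp R Y) (n+1)
  let φ : ProjectiveResolution.Hom P' P g :=
    ⟨ProjectiveResolution.lift g P' P, by
      simpa using ProjectiveResolution.lift_commutes_zero g P' P⟩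
  let Φ : K' ⟶ K := ((homOp R Y).mapHomologicalComplex (ComplexShape.down ℕ)).map φ.hom
  have nat : ((homOp R Y).leftDerived (n+1)).map g ≫ iso.hom =
      iso'.hom ≫ HomologicalComplex.homologyMap Φ (n+1) :=
    ProjectiveResolution.isoLeftDerivedObj_hom_naturality g P' P φ.hom
      (ProjectiveResolution.lift_commutes_zero g P' P) _ _
  clear_value iso iso'
  let a : K.homology (n+1) ⟶ op (ModuleCat.of R R) := iso.inv ≫ α
  have ha : α = iso.hom ≫ a := by simp [a]
  clear_value a
  have : Projective (ModuleCat.of R R) := inferInstance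
  have : Injective (op (ModuleCat.of R R)) := inferInstance
  let b : K.opcycles (n+1) ⟶ op (ModuleCat.of R R) := Injective.factorThru a (K.homologyι (n+1))
  have hb : K.homologyι (n+1) ≫ b = a := Injective.comp_factorThru _ _
  clear_value b
  obtain ⟨f, hf⟩ := pick_surj (R := R) (A := P.complex.X (n+1)) (Y := Y) (K.pOpcycles (n+1) ≫ b)
  have hf0 : P.complex.d (n+1+1) (n+1) ≫ f = 0 := by
    apply pick_inj (R := R)
    rw [← map_pick, hf]
    have : K.d (n+1+1) (n+1) ≫ K.pOpcycles (n+1) ≫ b = 0 := by simp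
    exact this.trans ((pickHom R _ _).map_zero).symm
  obtain ⟨c, hc⟩ := H (P.extMk f _ rfl hf0)
  rw [ProjectiveResolution.mk₀_comp_extMk f _ rfl hf0 φ] at hc
  obtain ⟨f', hf', rfl⟩ := P'.extMk_surjective c (n+1+1) rfl
  rw [nsmul_extMk, ← sub_eq_zero, ProjectiveResolution.sub_extMk,
    ProjectiveResolution.extMk_eq_zero_iff _ _ _ _ _ n rfl] at hc
  obtain ⟨h, hh⟩ := hc
  let q : K'.X (n+1) ⟶ op (ModuleCat.of R R) := pick R f'
  let r : K'.X n ⟶ op (ModuleCat.of R R) := pick R h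
  have hq : K'.d (n+1+1) (n+1) ≫ q = 0 := by
    refine (map_pick _ _).trans ?_
    rw [hf']
    exact (pickHom R _ _).map_zero
  have key : Φ.f (n+1) ≫ K.pOpcycles (n+1) ≫ b = p • q + K'.d (n+1) n ≫ r := by
    have e1 : Φ.f (n+1) ≫ K.pOpcycles (n+1) ≫ b = pick R (φ.hom.f (n+1) ≫ f) := by
      exact (congrArg (fun t : K.X (n+1) ⟶ _ => Φ.f (n+1) ≫ t) hf.symm).trans (map_pick _ _)
    have e2 : K'.d (n+1) n ≫ r = pick R (P'.complex.d (n+1) n ≫ h) := map_pick _ _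
    have e3 : φ.hom.f (n+1) ≫ f = p • f' + P'.complex.d (n+1) n ≫ h := by
      rw [hh]; abel
    have e4 : pick R (φ.hom.f (n+1) ≫ f) = p • pick R f' + pick R (P'.complex.d (n+1) n ≫ h) := by
      rw [e3, pick_add]
      exact congrArg (· + _) ((pickHom R _ _).map_nsmul p f')
    exact e1.trans (e4.trans (congrArg (fun t : K'.X (n+1) ⟶ _ => p • q + t) e2.symm))
  refine ⟨iso'.hom ≫ K'.homologyι (n+1) ≫ K'.descOpcycles q (n+1+1) (by simp) hq, ?_⟩
  rw [ha, ← Category.assoc, nat, Category.assoc, ← Preadditive.comp_nsmul]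
  congr 1
  rw [← hb, ← Preadditive.comp_nsmul, ← Category.assoc, HomologicalComplex.homologyι_naturality,
    Category.assoc]
  have e : HomologicalComplex.opcyclesMap Φ (n+1) ≫ b =
      p • K'.descOpcycles q (n+1+1) (by simp) hq + K'.fromOpcycles (n+1) n ≫ r := by
    rw [← cancel_epi (K'.pOpcycles (n+1))]
    simp [key]
  rw [e]
  simp
end Bridge

lemma bridgeExt {R : Type} [CommRing R] {X X' Y : ModuleCat.{0} R} (g : X' ⟶ X) (p n : ℕ)
    (H : ∀ a : Abelian.Ext.{0} X Y (n+1), ∃ c : Abelian.Ext.{0} X' Y (n+1),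
      (Abelian.Ext.mk₀ g).comp a (zero_add _) = p • c)
    (α : ((Ext R (ModuleCat.{0} R) (n+1)).obj (op X)).obj Y) :
    ∃ γ : ((Ext R (ModuleCat.{0} R) (n+1)).obj (op X')).obj Y,
      (((Ext R (ModuleCat.{0} R) (n+1)).map g.op).app Y).hom α = p • γ := by
  let F := homOp R Y
  let A : ModuleCat R := ((F.leftDerived (n+1)).obj X).unop
  let A' : ModuleCat R := ((F.leftDerived (n+1)).obj X').unop
  let m : ModuleCat.of R R ⟶ A := ModuleCat.ofHom (LinearMap.toSpanSingleton R A α)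
  obtain ⟨γ, hγ⟩ := bridge (R := R) g p n H m.op
  have h2 := congrArg (fun t => (show ModuleCat.of R R ⟶ A' from Quiver.Hom.unop t).hom (1 : R)) hγ
  refine ⟨(show ModuleCat.of R R ⟶ A' from γ.unop).hom (1 : R), ?_⟩
  refine Eq.trans ?_ h2
  have h3 : (LinearMap.toSpanSingleton R A α) 1 = α := one_smul _ _
  exact (congrArg (fun t : A => (((F.leftDerived (n+1)).map g).unop).hom t) h3).symm
section ExtDiv
variable {R : Type} [CommRing R]

lemma shortExact_mk {A B D : Type} [AddCommGroup A] [AddCommGroup B] [AddCommGroup D]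
    [Module R A] [Module R B] [Module R D] (f : A →ₗ[R] B) (g : B →ₗ[R] D)
    (hf : Function.Injective f) (hg : Function.Surjective g) (h : Function.Exact f g) :
    ∃ w, (ShortComplex.mk (ModuleCat.ofHom f) (ModuleCat.ofHom g) w).ShortExact := by
  refine ⟨?_, ?_⟩
  · ext x
    exact h.apply_apply_eq_zero x
  · refine ShortComplex.ShortExact.mk' ?_ ?_ ?_
    · rw [CategoryTheory.ShortComplex.ShortExact.moduleCat_exact_iff_function_exact]
      exact h
    · exact (ModuleCat.mono_iff_injective _).2 hf
    · exact (ModuleCat.epi_iff_surjective _).2 hg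

/-- The cyclic module `R / J`. -/
abbrev Q (J : Ideal R) : ModuleCat.{0} R := ModuleCat.of R (R ⧸ J)

/-- The projection `R / L → R / J`. -/
noncomputable abbrev pr {J' J : Ideal R} (h : J' ≤ J) : Q J' ⟶ Q J :=
  ModuleCat.ofHom (Submodule.mapQ J' J LinearMap.id h)

/-- The colon ideal `J : p`. -/
noncomputable def colonP (p : R) (J : Ideal R) : Ideal R :=
  Submodule.comap (LinearMap.mulLeft R p) J

lemma mem_colonP {p : R} {J : Ideal R} {x : R} : x ∈ colonP p J ↔ p * x ∈ J := Iff.rfl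

/-- Multiplication by `p` as a map `R / (J : p) → R / J`. -/
noncomputable def mulP (p : R) (J : Ideal R) : (R ⧸ colonP p J) →ₗ[R] (R ⧸ J) :=
  Submodule.mapQ (colonP p J) J (LinearMap.mulLeft R p) le_rfl

lemma mulP_exact (p : R) (J : Ideal R) :
    ∃ w, (ShortComplex.mk (ModuleCat.ofHom (mulP p J))
      (pr (le_sup_left : J ≤ J ⊔ Ideal.span {p})) w).ShortExact := by
  apply shortExact_mk
  · refine (injective_iff_map_eq_zero _).2 fun x hx => ?_
    obtain ⟨x, rfl⟩ := Submodule.mkQ_surjective _ x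
    have hx : p * x ∈ J := (Submodule.Quotient.mk_eq_zero _).1 hx
    exact (Submodule.Quotient.mk_eq_zero _).2 (mem_colonP.2 hx)
  · intro x
    obtain ⟨x, rfl⟩ := Submodule.mkQ_surjective _ x
    exact ⟨Submodule.mkQ _ x, rfl⟩
  · intro x
    obtain ⟨x, rfl⟩ := Submodule.mkQ_surjective _ x
    constructor
    · intro h
      have h : x ∈ J ⊔ Ideal.span {p} := (Submodule.Quotient.mk_eq_zero _).1 h
      obtain ⟨a, ha, b, hb, rfl⟩ := Submodule.mem_sup.1 h
      obtain ⟨c, rfl⟩ := Ideal.mem_span_singleton'.1 hb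
      refine ⟨Submodule.mkQ _ c, ?_⟩
      refine (Submodule.Quotient.eq _).2 ?_
      have : p * c - (a + c * p) = -a := by ring
      change p * c - (a + c * p) ∈ J
      rw [this]
      exact J.neg_mem ha
    · rintro ⟨y, hy⟩
      obtain ⟨y, rfl⟩ := Submodule.mkQ_surjective _ y
      rw [← hy]
      refine (Submodule.Quotient.mk_eq_zero _).2 ?_
      exact Submodule.mem_sup_right (Ideal.mem_span_singleton'.2 ⟨y, mul_comm _ _⟩)

lemma ext_div (p : ℕ) {J J' J'' K : Ideal R} (Y : ModuleCat.{0} R) (n : ℕ)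
    (h1 : J'' ≤ J') (h0 : J' ≤ J) (hcolon : ∀ x, (p : R) * x ∈ J' → x ∈ J)
    (hK1 : J'' ≤ K) (hK2 : (p : R) ∈ K) (hK3 : K ≤ J' ⊔ Ideal.span {(p : R)})
    (hext : ∀ e : Abelian.Ext.{0} (Q K) Y (n+1), e = 0)
    (a : Abelian.Ext.{0} (Q J) Y n) :
    ∃ c : Abelian.Ext.{0} (Q J'') Y n,
      (Abelian.Ext.mk₀ (pr (h1.trans h0))).comp a (zero_add _) = p • c := by
  obtain ⟨w', s'⟩ := mulP_exact (p : R) J'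
  obtain ⟨w'', s''⟩ := mulP_exact (p : R) J''
  have hL : colonP (p : R) J'' ≤ colonP (p : R) J' := fun x hx => h1 hx
  have hLJ : colonP (p : R) J' ≤ J := hcolon
  have hJL : J'' ≤ colonP (p : R) J'' := fun x hx => J''.mul_mem_left _ hx
  have hs : J'' ⊔ Ideal.span {(p : R)} ≤ K :=
    sup_le hK1 ((Ideal.span_singleton_le_iff_mem _).2 hK2)
  let F : ShortComplex.mk _ _ w'' ⟶ ShortComplex.mk _ _ w' :=
    { τ₁ := pr hL
      τ₂ := pr h1
      τ₃ := pr (hs.trans hK3)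
      comm₁₂ := by
        ext
        rfl
      comm₂₃ := by
        ext
        rfl }
  let b := (Abelian.Ext.mk₀ (pr hLJ)).comp a (zero_add _)
  have key : s''.extClass.comp ((Abelian.Ext.mk₀ (pr hL)).comp b (zero_add _)) (add_comm 1 n) = 0 := by
    have nat := ShortComplex.ShortExact.extClass_naturality s'' s' F
    rw [← Abelian.Ext.comp_assoc_of_second_deg_zero]
    have e : s''.extClass.comp (Abelian.Ext.mk₀ (pr hL)) (add_zero 1) =
      (Abelian.Ext.mk₀ (pr (hs.trans hK3))).comp s'.extClass (zero_add 1) := nat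
    rw [e]
    have e2 : pr (hs.trans hK3) = pr hs ≫ pr hK3 := by
      ext
      rfl
    rw [Abelian.Ext.comp_assoc _ _ _ _ (add_comm 1 n) (by lia), e2,
      ← Abelian.Ext.mk₀_comp_mk₀_assoc, hext ((Abelian.Ext.mk₀ (pr hK3)).comp _ _),
      Abelian.Ext.comp_zero]
  obtain ⟨c, hc⟩ := Abelian.Ext.contravariant_sequence_exact₁ s'' _ _ _ key
  refine ⟨c, ?_⟩
  have hc2 := congrArg (fun t => (Abelian.Ext.mk₀ (pr hJL)).comp t (zero_add _)) hc
  simp only [b, Abelian.Ext.mk₀_comp_mk₀_assoc] at hc2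
  have e1 : pr (h1.trans h0) = pr hJL ≫ pr hL ≫ pr hLJ := by
    ext
    rfl
  have e2 : pr hJL ≫ ModuleCat.ofHom (mulP (p : R) J'') = p • 𝟙 (Q J'') := by
    ext
    change Submodule.mkQ J'' ((p : R) * 1) = p • Submodule.mkQ J'' 1
    rw [← map_nsmul]
    simp
  have e3 : ∀ k : ℕ, (Abelian.Ext.mk₀ (k • 𝟙 (Q J''))).comp c (zero_add _) = k • c := by
    intro k
    induction k with
    | zero => simp
    | succ k ih => simp [succ_nsmul, Abelian.Ext.mk₀_add, ih]
  rw [e1, ← hc2, ← e3, ← e2]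

end ExtDiv
section HilbertBurch

lemma hilbert_burch {A : Type*} [CommRing A] [IsDomain A] [DecompositionMonoid A]
    {a1 a2 a3 b1 b2 b3 c1 c2 c3 : A}
    (hrel : IsRelPrime (a2 * b3 - a3 * b2) (a1 * b2 - a2 * b1)) (h0 : a1 * b2 - a2 * b1 ≠ 0)
    (hc : c1 * (a2 * b3 - a3 * b2) + c2 * (a3 * b1 - a1 * b3) + c3 * (a1 * b2 - a2 * b1) = 0) :
    ∃ s t, c1 = s * a1 + t * b1 ∧ c2 = s * a2 + t * b2 ∧ c3 = s * a3 + t * b3 := by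
  have d1 : (a1 * b2 - a2 * b1) ∣ (a2 * b3 - a3 * b2) * (c1 * b2 - c2 * b1) :=
    ⟨c2 * b3 - c3 * b2, by linear_combination b2 * hc⟩
  have d2 : (a1 * b2 - a2 * b1) ∣ (a2 * b3 - a3 * b2) * (a1 * c2 - a2 * c1) :=
    ⟨a2 * c3 - a3 * c2, by linear_combination (-a2) * hc⟩
  obtain ⟨s, hs⟩ := hrel.symm.dvd_of_dvd_mul_left d1
  obtain ⟨t, ht⟩ := hrel.symm.dvd_of_dvd_mul_left d2
  refine ⟨s, t, ?_, ?_, ?_⟩ <;> apply mul_left_cancel₀ h0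
  · linear_combination a1 * hs + b1 * ht
  · linear_combination a2 * hs + b2 * ht
  · linear_combination a3 * hs + b3 * ht + hc

lemma hilbert_burch_inj {A : Type*} [CommRing A] [IsDomain A]
    {a1 a2 b1 b2 s t : A} (h0 : a1 * b2 - a2 * b1 ≠ 0)
    (h1 : s * a1 + t * b1 = 0) (h2 : s * a2 + t * b2 = 0) : s = 0 ∧ t = 0 := by
  constructor <;> apply mul_left_cancel₀ h0
  · linear_combination b2 * h1 - b1 * h2
  · linear_combination a1 * h2 - a2 * h1

open MvPolynomial in
lemma D3_ne {k : Type*} [CommRing k] [IsDomain k] {q : ℕ} (hq : q ≠ 0) :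
    (X 0 ^ q * X 4 ^ q - X 1 ^ q * X 3 ^ q : MvPolynomial (Fin 6) k) ≠ 0 := by
  intro h
  have := congrArg (eval ![1, 0, 0, 0, 1, 0]) h
  simp [hq] at this

open MvPolynomial in
lemma relPrime_minors {k : Type*} [CommRing k] [IsDomain k] {q : ℕ} (hq : q ≠ 0) :
    IsRelPrime (X 1 ^ q * X 5 ^ q - X 2 ^ q * X 4 ^ q : MvPolynomial (Fin 6) k)
      (X 0 ^ q * X 4 ^ q - X 1 ^ q * X 3 ^ q) := by
  intro d h1 h3
  have hdeg : ∀ i : Fin 6, i = 2 ∨ i = 5 → i ∉ d.vars := by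
    intro i hi
    rw [mem_vars_iff_degreeOf_ne_zero, not_not]
    obtain ⟨e, he⟩ := h3
    have hne := D3_ne (k := k) hq
    have hd : d ≠ 0 := by rintro rfl; simp [he] at hne
    have he0 : e ≠ 0 := by rintro rfl; simp [he] at hne
    have hz : degreeOf i (X 0 ^ q * X 4 ^ q - X 1 ^ q * X 3 ^ q : MvPolynomial (Fin 6) k) = 0 := by
      have z : ∀ j : Fin 6, i ≠ j → degreeOf i (X j ^ q : MvPolynomial (Fin 6) k) = 0 := by
        intro j hj
        have := degreeOf_pow_le i (X j : MvPolynomial (Fin 6) k) q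
        rw [degreeOf_X, if_neg hj] at this
        simpa using this
      have m : ∀ j l : Fin 6, i ≠ j → i ≠ l →
          degreeOf i (X j ^ q * X l ^ q : MvPolynomial (Fin 6) k) = 0 := by
        intro j l hj hl
        have := degreeOf_mul_le i (X j ^ q : MvPolynomial (Fin 6) k) (X l ^ q)
        rw [z j hj, z l hl] at this
        simpa using this
      have := degreeOf_sub_le i (X 0 ^ q * X 4 ^ q : MvPolynomial (Fin 6) k) (X 1 ^ q * X 3 ^ q)
      rw [m 0 4 (by rcases hi with rfl | rfl <;> decide) (by rcases hi with rfl | rfl <;> decide),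
        m 1 3 (by rcases hi with rfl | rfl <;> decide)
          (by rcases hi with rfl | rfl <;> decide)] at this
      simpa using this
    rw [he, degreeOf_mul_eq hd he0] at hz
    omega
  have hsub : ∀ g : Fin 6 → MvPolynomial (Fin 6) k, (∀ i, i ≠ 2 → i ≠ 5 → g i = X i) →
      aeval g d = d := by
    intro g hg
    have : (aeval g : MvPolynomial (Fin 6) k →ₐ[k] _).toRingHom d = (RingHom.id _) d := by
      apply hom_congr_vars
      · ext
        simp
      · intro i hi _
        have h2 : i ≠ 2 := fun h => hdeg i (Or.inl h) hi
        have h5 : i ≠ 5 := fun h => hdeg i (Or.inr h) hi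
        simpa using hg i h2 h5
      · rfl
    exact this
  have hv : d ∣ X 1 ^ q := by
    have := map_dvd (aeval ![X 0, X 1, 0, X 3, X 4, 1] :
      MvPolynomial (Fin 6) k →ₐ[k] MvPolynomial (Fin 6) k) h1
    rw [hsub _ (by intro i; fin_cases i <;> simp)] at this
    simpa [hq] using this
  have hy : d ∣ X 4 ^ q := by
    have := map_dvd (aeval ![X 0, X 1, 1, X 3, X 4, 0] :
      MvPolynomial (Fin 6) k →ₐ[k] MvPolynomial (Fin 6) k) h1
    rw [hsub _ (by intro i; fin_cases i <;> simp)] at this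
    simpa [hq] using this
  have hXi : ∀ i : Fin 6, Prime (X i : MvPolynomial (Fin 6) k) := fun i => X_prime
  obtain ⟨i, _, hi⟩ := (dvd_prime_pow (hXi 1) q).1 hv
  rcases Nat.eq_zero_or_pos i with rfl | hpos
  · rw [pow_zero] at hi
    exact hi.symm.isUnit isUnit_one
  · exfalso
    have h14 : (X 1 : MvPolynomial (Fin 6) k) ∣ X 4 ^ q :=
      ((dvd_pow_self _ hpos.ne').trans hi.symm.dvd).trans hy
    have := (hXi 1).dvd_of_dvd_pow h14
    rw [X_dvd_X] at this
    exact absurd this (by decide)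

end HilbertBurch
section PD
open CategoryTheory Opposite Limits

lemma pd_HB {A : Type} [CommRing A] [IsDomain A] [DecompositionMonoid A]
    {a1 a2 a3 b1 b2 b3 : A}
    (hrel : IsRelPrime (a2 * b3 - a3 * b2) (a1 * b2 - a2 * b1)) (h0 : a1 * b2 - a2 * b1 ≠ 0) :
    HasProjectiveDimensionLT
      (Q (Ideal.span {a2 * b3 - a3 * b2, a3 * b1 - a1 * b3, a1 * b2 - a2 * b1})) 3 := by
  set J := Ideal.span {a2 * b3 - a3 * b2, a3 * b1 - a1 * b3, a1 * b2 - a2 * b1} with hJ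
  let f : (A × A) →ₗ[A] (A × A × A) :=
    { toFun := fun c => (c.1 * a1 + c.2 * b1, c.1 * a2 + c.2 * b2, c.1 * a3 + c.2 * b3)
      map_add' := by intro c d; ext <;> simp <;> ring
      map_smul' := by intro c d; ext <;> simp <;> ring }
  let g0 : (A × A × A) →ₗ[A] A :=
    { toFun := fun c => c.1 * (a2 * b3 - a3 * b2) + c.2.1 * (a3 * b1 - a1 * b3)
        + c.2.2 * (a1 * b2 - a2 * b1)
      map_add' := by intro c d; simp; ring
      map_smul' := by intro c d; simp; ring }
  have hmem : ∀ c, g0 c ∈ J := by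
    intro c
    refine Ideal.add_mem _ (Ideal.add_mem _ ?_ ?_) ?_ <;>
      exact Ideal.mul_mem_left _ _ (Ideal.subset_span (by simp))
  let g : (A × A × A) →ₗ[A] J := g0.codRestrict J hmem
  have hf : Function.Injective f := by
    rw [← LinearMap.ker_eq_bot, LinearMap.ker_eq_bot']
    rintro ⟨s, t⟩ h
    have h1 : s * a1 + t * b1 = 0 := congrArg (fun c => c.1) h
    have h2 : s * a2 + t * b2 = 0 := congrArg (fun c => c.2.1) h
    obtain ⟨rfl, rfl⟩ := hilbert_burch_inj h0 h1 h2
    rfl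
  have hg : Function.Surjective g := by
    rintro ⟨x, hx⟩
    rw [hJ, Ideal.mem_span_insert] at hx
    obtain ⟨c1, y, hy, rfl⟩ := hx
    rw [Ideal.mem_span_pair] at hy
    obtain ⟨c2, c3, rfl⟩ := hy
    refine ⟨(c1, c2, c3), Subtype.ext ?_⟩
    change c1 * _ + c2 * _ + c3 * _ = _
    ring
  have hex : Function.Exact f g := by
    rintro ⟨c1, c2, c3⟩
    constructor
    · intro h
      have h' : c1 * (a2 * b3 - a3 * b2) + c2 * (a3 * b1 - a1 * b3)
        + c3 * (a1 * b2 - a2 * b1) = 0 := congrArg Subtype.val h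
      obtain ⟨s, t, rfl, rfl, rfl⟩ := hilbert_burch hrel h0 h'
      exact ⟨(s, t), rfl⟩
    · rintro ⟨⟨s, t⟩, h⟩
      rw [← h]
      apply Subtype.ext
      change (s * a1 + t * b1) * _ + (s * a2 + t * b2) * _ + (s * a3 + t * b3) * _ = 0
      ring
  obtain ⟨w1, S1⟩ := shortExact_mk f g hf hg hex
  obtain ⟨w2, S2⟩ := shortExact_mk J.subtype J.mkQ J.injective_subtype J.mkQ_surjective
    (by rw [LinearMap.exact_iff]; simp)
  have pr1 : ∀ (M : Type) [AddCommGroup M] [Module A M] [Module.Projective A M],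
      HasProjectiveDimensionLT (ModuleCat.of A M) 1 := by
    intro M _ _ _
    have : Projective (ModuleCat.of A M) := by
      infer_instance
    infer_instance
  have p1 : HasProjectiveDimensionLT (ModuleCat.of A J) 2 :=
    S1.hasProjectiveDimensionLT_X₃ 1 (pr1 (A × A))
      (have := pr1 (A × A × A); hasProjectiveDimensionLT_of_ge _ 1 2 (by norm_num))
  exact S2.hasProjectiveDimensionLT_X₃ 2 p1
      (have := pr1 A; hasProjectiveDimensionLT_of_ge _ 1 3 (by norm_num))

end PD
section Arith
open MvPolynomial

lemma colon_minors (p : ℕ) (hp : p.Prime) {q : ℕ} (hq : q ≠ 0) (x : MvPolynomial (Fin 6) ℤ)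
    (hx : (p : MvPolynomial (Fin 6) ℤ) * x ∈ Ideal.span
      ({X 1 ^ q * X 5 ^ q - X 2 ^ q * X 4 ^ q, X 2 ^ q * X 3 ^ q - X 0 ^ q * X 5 ^ q,
        X 0 ^ q * X 4 ^ q - X 1 ^ q * X 3 ^ q} : Set (MvPolynomial (Fin 6) ℤ))) :
    x ∈ Ideal.span
      ({X 1 ^ q * X 5 ^ q - X 2 ^ q * X 4 ^ q, X 2 ^ q * X 3 ^ q - X 0 ^ q * X 5 ^ q,
        X 0 ^ q * X 4 ^ q - X 1 ^ q * X 3 ^ q} : Set (MvPolynomial (Fin 6) ℤ)) := by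
  have : Fact p.Prime := ⟨hp⟩
  rw [Ideal.mem_span_insert] at hx
  obtain ⟨c1, y, hy, hx⟩ := hx
  rw [Ideal.mem_span_pair] at hy
  obtain ⟨c2, c3, rfl⟩ := hy
  let φ : MvPolynomial (Fin 6) ℤ →+* MvPolynomial (Fin 6) (ZMod p) :=
    map (Int.castRingHom (ZMod p))
  have hφ : Function.Surjective φ := map_surjective _ (ZMod.ringHom_surjective _)
  have hker : ∀ f, φ f = 0 → ∃ g, f = (p : MvPolynomial (Fin 6) ℤ) * g := by
    intro f hf
    obtain ⟨g, hg⟩ := (C_dvd_iff_zmod p f).2 hf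
    exact ⟨g, by simpa using hg⟩
  have hp0 : φ (p : MvPolynomial (Fin 6) ℤ) = 0 := by
    rw [map_natCast]
    exact CharP.cast_eq_zero _ p
  have h := congrArg φ hx
  rw [map_mul, hp0, zero_mul] at h
  have hX : ∀ i, φ (X i) = X i := fun i => map_X _ i
  simp only [map_add, map_mul, map_sub, map_pow, hX] at h
  obtain ⟨s, t, h1, h2, h3⟩ := hilbert_burch (A := MvPolynomial (Fin 6) (ZMod p))
    (a1 := X 0 ^ q) (a2 := X 1 ^ q) (a3 := X 2 ^ q) (b1 := X 3 ^ q) (b2 := X 4 ^ q)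
    (b3 := X 5 ^ q) (c1 := φ c1) (c2 := φ c2) (c3 := φ c3)
    (relPrime_minors hq) (D3_ne hq) (by linear_combination -h)
  obtain ⟨s, rfl⟩ := hφ s
  obtain ⟨t, rfl⟩ := hφ t
  obtain ⟨e1, he1⟩ := hker (c1 - (s * X 0 ^ q + t * X 3 ^ q)) (by simp [h1, hX])
  obtain ⟨e2, he2⟩ := hker (c2 - (s * X 1 ^ q + t * X 4 ^ q)) (by simp [h2, hX])
  obtain ⟨e3, he3⟩ := hker (c3 - (s * X 2 ^ q + t * X 5 ^ q)) (by simp [h3, hX])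
  have hpne : (p : MvPolynomial (Fin 6) ℤ) ≠ 0 := by exact_mod_cast hp.ne_zero
  have : x = e1 * (X 1 ^ q * X 5 ^ q - X 2 ^ q * X 4 ^ q)
      + (e2 * (X 2 ^ q * X 3 ^ q - X 0 ^ q * X 5 ^ q)
      + e3 * (X 0 ^ q * X 4 ^ q - X 1 ^ q * X 3 ^ q)) := by
    apply mul_left_cancel₀ hpne
    linear_combination hx + (X 1 ^ q * X 5 ^ q - X 2 ^ q * X 4 ^ q) * he1
      + (X 2 ^ q * X 3 ^ q - X 0 ^ q * X 5 ^ q) * he2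
      + (X 0 ^ q * X 4 ^ q - X 1 ^ q * X 3 ^ q) * he3
  rw [this]
  refine Ideal.add_mem _ ?_ (Ideal.add_mem _ ?_ ?_) <;>
    exact Ideal.mul_mem_left _ _ (Ideal.subset_span (by simp))

lemma frob_minor (p : ℕ) (hp : p.Prime) (e : ℕ) (i j k l : Fin 6) :
    ∃ g : MvPolynomial (Fin 6) ℤ, (X i * X j - X k * X l) ^ (p ^ e) =
      (X i ^ (p ^ e) * X j ^ (p ^ e) - X k ^ (p ^ e) * X l ^ (p ^ e)) + (p : MvPolynomial (Fin 6) ℤ) * g := by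
  have : Fact p.Prime := ⟨hp⟩
  have : map (Int.castRingHom (ZMod p)) ((X i * X j - X k * X l) ^ (p ^ e) -
      (X i ^ (p ^ e) * X j ^ (p ^ e) - X k ^ (p ^ e) * X l ^ (p ^ e)) :
      MvPolynomial (Fin 6) ℤ) = 0 := by
    simp only [map_mul, map_sub, map_pow, map_X]
    rw [sub_pow_char_pow, mul_pow, mul_pow, sub_self]
  obtain ⟨g, hg⟩ := (C_dvd_iff_zmod p _).2 this
  exact ⟨g, by rw [← sub_eq_iff_eq_add', hg]; simp⟩

lemma artin_rees_colon {A : Type*} [CommRing A] [IsNoetherianRing A] [IsDomain A]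
    (I : Ideal A) (a : A) (ha : a ≠ 0) (t : ℕ) :
    ∃ t', t ≤ t' ∧ ∀ x, a * x ∈ I ^ t' → x ∈ I ^ t := by
  obtain ⟨k, hk⟩ := I.exists_pow_inf_eq_pow_smul (M := A) (Ideal.span {a})
  refine ⟨t + k, by omega, fun x hx => ?_⟩
  have h := hk (t + k) (by omega)
  have hmem : a * x ∈ (I ^ (t + k) • (⊤ : Ideal A) ⊓ Ideal.span {a} : Ideal A) :=
    ⟨by simpa using hx, Ideal.mul_mem_right _ _ (Ideal.mem_span_singleton_self a)⟩
  rw [h, Nat.add_sub_cancel] at hmem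
  have h2 : a * x ∈ I ^ t * Ideal.span {a} :=
    (Ideal.mul_mono_right (I := I ^ t) inf_le_right : _ * _ ≤ I ^ t * Ideal.span {a}) hmem
  rw [Ideal.mem_mul_span_singleton] at h2
  obtain ⟨z, hz, hzx⟩ := h2
  have : z = x := mul_left_cancel₀ ha (by rw [← hzx, mul_comm])
  exact this ▸ hz

end Arith
end Helpers

open MvPolynomial

noncomputable def U : MvPolynomial (Fin 6) ℤ := X 0
noncomputable def V : MvPolynomial (Fin 6) ℤ := X 1
noncomputable def W : MvPolynomial (Fin 6) ℤ := X 2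
noncomputable def Xx : MvPolynomial (Fin 6) ℤ := X 3
noncomputable def Yy : MvPolynomial (Fin 6) ℤ := X 4
noncomputable def Zz : MvPolynomial (Fin 6) ℤ := X 5

noncomputable def Δ1 : MvPolynomial (Fin 6) ℤ := V * Zz - W * Yy
noncomputable def Δ2 : MvPolynomial (Fin 6) ℤ := W * Xx - U * Zz
noncomputable def Δ3 : MvPolynomial (Fin 6) ℤ := U * Yy - V * Xx

/-- The ideal of size-two minors of the generic `2 × 3` matrix over `ℤ`. -/
noncomputable def I23 : Ideal (MvPolynomial (Fin 6) ℤ) := Ideal.span {Δ1, Δ2, Δ3}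

section Final
open CategoryTheory Opposite Limits

lemma key_power (p : ℕ) (hp : p.Prime) (t : ℕ) :
    ∃ t'', ∃ h : t ≤ t'', ∀ a : Abelian.Ext.{0} (Q (I23 ^ t))
        (ModuleCat.of (MvPolynomial (Fin 6) ℤ) (MvPolynomial (Fin 6) ℤ)) 3,
      ∃ c : Abelian.Ext.{0} (Q (I23 ^ t''))
        (ModuleCat.of (MvPolynomial (Fin 6) ℤ) (MvPolynomial (Fin 6) ℤ)) 3,
      (Abelian.Ext.mk₀ (pr (Ideal.pow_le_pow_right h))).comp a (zero_add _) = p • c := by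
  have hpne : (p : MvPolynomial (Fin 6) ℤ) ≠ 0 := by exact_mod_cast hp.ne_zero
  obtain ⟨t', htt', hcolon⟩ := artin_rees_colon I23 (p : MvPolynomial (Fin 6) ℤ) hpne t
  obtain ⟨q, hq⟩ : ∃ q, q = p ^ t' := ⟨_, rfl⟩
  have hq0 : q ≠ 0 := hq ▸ pow_ne_zero _ hp.ne_zero
  have hqt : t' ≤ q := hq ▸ (Nat.lt_pow_self hp.one_lt).le
  obtain ⟨D, hD⟩ : ∃ D, D = Ideal.span
      ({X 1 ^ q * X 5 ^ q - X 2 ^ q * X 4 ^ q, X 2 ^ q * X 3 ^ q - X 0 ^ q * X 5 ^ q,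
        X 0 ^ q * X 4 ^ q - X 1 ^ q * X 3 ^ q} : Set (MvPolynomial (Fin 6) ℤ)) := ⟨_, rfl⟩
  obtain ⟨g1, hg1⟩ := frob_minor p hp t' 1 5 2 4
  obtain ⟨g2, hg2⟩ := frob_minor p hp t' 2 3 0 5
  obtain ⟨g3, hg3⟩ := frob_minor p hp t' 0 4 1 3
  rw [← hq] at hg1 hg2 hg3
  have hpd : HasProjectiveDimensionLT (Q D) 3 := by
    rw [hD]
    exact pd_HB (relPrime_minors hq0) (D3_ne hq0)
  have hcol : colonP (p : MvPolynomial (Fin 6) ℤ) D = D := by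
    ext x
    rw [mem_colonP]
    exact ⟨fun h => hD ▸ colon_minors p hp hq0 x (hD ▸ h), fun h => D.mul_mem_left _ h⟩
  have hpdK : HasProjectiveDimensionLT
      (Q (D ⊔ Ideal.span {(p : MvPolynomial (Fin 6) ℤ)})) 4 := by
    obtain ⟨w, S⟩ := mulP_exact (p : MvPolynomial (Fin 6) ℤ) D
    refine S.hasProjectiveDimensionLT_X₃ 3 ?_ ?_
    · change HasProjectiveDimensionLT (Q (colonP (p : MvPolynomial (Fin 6) ℤ) D)) 3
      rw [hcol]
      exact hpd
    · exact hasProjectiveDimensionLT_of_ge _ 3 4 (by norm_num)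
  have hpK : ∀ J : Ideal (MvPolynomial (Fin 6) ℤ), ∀ g, (p : MvPolynomial (Fin 6) ℤ) * g ∈
      J ⊔ Ideal.span {(p : MvPolynomial (Fin 6) ℤ)} := fun J g =>
    Ideal.mul_mem_right _ _ (Ideal.mem_sup_right (Ideal.mem_span_singleton_self _))
  have hrad : I23 ≤ (D ⊔ Ideal.span {(p : MvPolynomial (Fin 6) ℤ)}).radical := by
    rw [I23, Ideal.span_le]
    rintro x (rfl | rfl | rfl)
    · refine ⟨q, ?_⟩
      rw [Δ1, V, Zz, W, Yy, hg1]
      exact Ideal.add_mem _ (Ideal.mem_sup_left (hD ▸ Ideal.subset_span (by simp))) (hpK _ _)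
    · refine ⟨q, ?_⟩
      rw [Δ2, W, Xx, U, Zz, hg2]
      exact Ideal.add_mem _ (Ideal.mem_sup_left (hD ▸ Ideal.subset_span (by simp))) (hpK _ _)
    · refine ⟨q, ?_⟩
      rw [Δ3, V, Xx, U, Yy, hg3]
      exact Ideal.add_mem _ (Ideal.mem_sup_left (hD ▸ Ideal.subset_span (by simp))) (hpK _ _)
  obtain ⟨m, hm⟩ := Ideal.exists_pow_le_of_le_radical_of_fg hrad
    ((isNoetherianRing_iff_ideal_fg _).1 inferInstance _)
  have hmem : ∀ d ∈ I23, d ^ q ∈ I23 ^ t' := fun d hd =>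
    Ideal.pow_le_pow_right hqt (Ideal.pow_mem_pow hd q)
  have hΔ1 : X 1 * X 5 - X 2 * X 4 ∈ I23 := by
    rw [I23]; exact Ideal.subset_span (Or.inl rfl)
  have hΔ2 : X 2 * X 3 - X 0 * X 5 ∈ I23 := by
    rw [I23]; exact Ideal.subset_span (Or.inr (Or.inl rfl))
  have hΔ3 : X 0 * X 4 - X 1 * X 3 ∈ I23 := by
    rw [I23]; exact Ideal.subset_span (Or.inr (Or.inr rfl))
  have hK3 : D ⊔ Ideal.span {(p : MvPolynomial (Fin 6) ℤ)} ≤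
      I23 ^ t' ⊔ Ideal.span {(p : MvPolynomial (Fin 6) ℤ)} := by
    refine sup_le ?_ le_sup_right
    rw [hD, Ideal.span_le]
    rintro x (rfl | rfl | rfl)
    · rw [SetLike.mem_coe, eq_sub_iff_add_eq.2 hg1.symm]
      exact Ideal.sub_mem _ (Ideal.mem_sup_left (hmem _ hΔ1)) (hpK _ _)
    · rw [SetLike.mem_coe, eq_sub_iff_add_eq.2 hg2.symm]
      exact Ideal.sub_mem _ (Ideal.mem_sup_left (hmem _ hΔ2)) (hpK _ _)
    · rw [SetLike.mem_coe, eq_sub_iff_add_eq.2 hg3.symm]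
      exact Ideal.sub_mem _ (Ideal.mem_sup_left (hmem _ hΔ3)) (hpK _ _)
  refine ⟨max t' m, htt'.trans (le_max_left _ _), fun a => ?_⟩
  exact ext_div p _ 3 (Ideal.pow_le_pow_right (le_max_left _ _)) (Ideal.pow_le_pow_right htt')
    hcolon ((Ideal.pow_le_pow_right (le_max_right _ _)).trans hm)
    (Ideal.mem_sup_right (Ideal.mem_span_singleton_self _)) hK3
    (fun e => e.eq_zero_of_hasProjectiveDimensionLT 4 le_rfl) a

end Final

section Colim
open CategoryTheory Opposite Limits

lemma colim_div {R : Type} [CommRing R] {J : Type} [SmallCategory J] (F : J ⥤ ModuleCat.{0} R)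
    (c : Cocone F) (hc : IsColimit c) (p : ℕ)
    (H : ∀ j, ∃ j', ∃ f : j ⟶ j', ∀ a : F.obj j, ∃ b : F.obj j', (F.map f).hom a = p • b)
    (x : c.pt) : ∃ y : c.pt, p • y = x := by
  let N : Submodule R c.pt := LinearMap.range (p • (LinearMap.id : c.pt →ₗ[R] c.pt))
  have h : ModuleCat.ofHom N.mkQ = 0 := by
    apply hc.hom_ext
    intro j
    ext a
    obtain ⟨j', f, hf⟩ := H j
    obtain ⟨b, hb⟩ := hf a
    have e : (c.ι.app j).hom a = p • (c.ι.app j').hom b := by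
      rw [← c.w f, ModuleCat.hom_comp, LinearMap.comp_apply, hb, map_nsmul]
    change N.mkQ ((c.ι.app j).hom a) = 0
    rw [e]
    exact (Submodule.Quotient.mk_eq_zero _).2 ⟨_, rfl⟩
  have hx : N.mkQ x = 0 := by
    have := congrArg (fun f => f.hom x) h
    exact this
  obtain ⟨y, hy⟩ := (Submodule.Quotient.mk_eq_zero _).1 hx
  exact ⟨y, hy⟩

lemma loc_div {R : Type} [CommRing R] (I : Ideal R) (M : ModuleCat.{0} R) (p n : ℕ)
    (H : ∀ t, ∃ t'', ∃ h : t ≤ t'', ∀ a : Abelian.Ext.{0} (Q (I ^ t)) M (n+1),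
      ∃ c : Abelian.Ext.{0} (Q (I ^ t'')) M (n+1),
      (Abelian.Ext.mk₀ (pr (Ideal.pow_le_pow_right h))).comp a (zero_add _) = p • c)
    (x : (localCohomology I (n+1)).obj M) : ∃ y : (localCohomology I (n+1)).obj M, p • y = x := by
  let F := localCohomology.diagram (localCohomology.idealPowersDiagram I) (n+1)
  have := localCohomology.hasColimitDiagram.{0, 0} (localCohomology.idealPowersDiagram I) (n+1)
  refine colim_div (F ⋙ (evaluation _ _).obj M) _
    (isColimitOfPreserves ((evaluation _ _).obj M) (colimit.isColimit F)) p ?_ x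
  intro j
  obtain ⟨t'', h, ht⟩ := H (unop (unop j))
  refine ⟨op (op t''), (homOfLE h).op.op, fun a => ?_⟩
  exact bridgeExt (pr (Ideal.pow_le_pow_right h)) p n ht a

end Colim

/-- For every prime `p`, multiplication by `p` is surjective on `H³_I(R)`, i.e. `H³_I(R)` is
a divisible abelian group. -/
theorem third_local_cohomology_divisible (p : ℕ) (hp : p.Prime) :
    Function.Surjective
      (fun m : (localCohomology I23 3).obj
          (ModuleCat.of (MvPolynomial (Fin 6) ℤ) (MvPolynomial (Fin 6) ℤ)) =>
        (p : ℤ) • m) := by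

  intro m
  obtain ⟨y, hy⟩ := loc_div I23 _ p 2 (key_power p hp) m
  exact ⟨y, by simpa using hy⟩
end

section
/- Let R = ℤ[u,v,w,x,y,z] and I = (Δ1, Δ2, Δ3) the ideal of size-2 minors of the generic 2×3 matrix. For every prime integer p, multiplication by p on the local cohomology module H³_I(R) is injective; that is, H³_I(R) has no p-torsion for any prime p. -/
open MvPolynomial

noncomputable section Bridge
open CategoryTheory Opposite Limits

variable {R : Type} [CommRing R]

/-- cochains in the unopposed complex -/
def UnRep (K : ChainComplex (ModuleCat.{0} R)ᵒᵖ ℕ) (n : ℕ) (φ : (K.X n).unop)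
    (m : (K.homology n).unop) : Prop :=
  ∃ c : (K.opcycles n).unop, (K.homologyι n).unop c = m ∧ (K.pOpcycles n).unop c = φ

lemma UnRep.exists (K : ChainComplex (ModuleCat.{0} R)ᵒᵖ ℕ) (n : ℕ) (m : (K.homology n).unop) :
    ∃ φ, UnRep K n φ m := by
  have : Function.Surjective (K.homologyι n).unop := by
    rw [← ModuleCat.epi_iff_surjective]; infer_instance
  obtain ⟨c, hc⟩ := this m
  exact ⟨_, c, hc, rfl⟩

lemma UnRep.smul {K : ChainComplex (ModuleCat.{0} R)ᵒᵖ ℕ} {n : ℕ} {φ : (K.X n).unop}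
    {m : (K.homology n).unop} (h : UnRep K n φ m) (r : R) : UnRep K n (r • φ) (r • m) := by
  obtain ⟨c, h1, h2⟩ := h
  exact ⟨r • c, by simp [h1], by simp [h2]⟩

lemma UnRep.map {K L : ChainComplex (ModuleCat.{0} R)ᵒᵖ ℕ} (f : K ⟶ L) {n : ℕ} {φ : (L.X n).unop}
    {m : (L.homology n).unop} (h : UnRep L n φ m) :
    UnRep K n ((f.f n).unop φ) ((HomologicalComplex.homologyMap f n).unop m) := by
  obtain ⟨c, h1, h2⟩ := h
  refine ⟨(HomologicalComplex.opcyclesMap f n).unop c, ?_, ?_⟩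
  · rw [← h1, ← ModuleCat.comp_apply, ← ModuleCat.comp_apply, ← unop_comp, ← unop_comp,
      HomologicalComplex.homologyι_naturality]
  · rw [← h2, ← ModuleCat.comp_apply, ← ModuleCat.comp_apply, ← unop_comp, ← unop_comp,
      HomologicalComplex.p_opcyclesMap]

lemma UnRep.closed {K : ChainComplex (ModuleCat.{0} R)ᵒᵖ ℕ} {n : ℕ} {φ : (K.X n).unop}
    {m : (K.homology n).unop} (h : UnRep K n φ m) (i : ℕ) : (K.d i n).unop φ = 0 := by
  obtain ⟨c, h1, h2⟩ := h
  rw [← h2, ← ModuleCat.comp_apply, ← unop_comp, HomologicalComplex.d_pOpcycles]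
  rfl

lemma UnRep.zero {K : ChainComplex (ModuleCat.{0} R)ᵒᵖ ℕ} {n : ℕ} {φ : (K.X (n+1)).unop}
    (h : UnRep K (n+1) φ 0) : ∃ ψ : (K.X n).unop, (K.d (n+1) n).unop ψ = φ := by
  obtain ⟨c, h1, h2⟩ := h
  have ex : (ShortComplex.mk (K.homologyι (n+1)) (K.fromOpcycles (n+1) n) (by simp)).Exact := by
    apply ShortComplex.exact_of_f_is_kernel
    exact K.homologyIsKernel (n+1) n (by simp)
  have ex' := ex.unop
  rw [ShortComplex.moduleCat_exact_iff] at ex'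
  obtain ⟨ψ, hψ⟩ := ex' c h1
  refine ⟨ψ, ?_⟩
  rw [← h2, ← hψ]
  have e := congrArg Quiver.Hom.unop (HomologicalComplex.p_fromOpcycles K (n+1) n)
  exact (ConcreteCategory.congr_hom e ψ).symm

lemma UnRep.eq_zero {K : ChainComplex (ModuleCat.{0} R)ᵒᵖ ℕ} {n : ℕ} {ψ : (K.X n).unop}
    {m : (K.homology (n+1)).unop}
    (h : UnRep K (n+1) ((K.d (n+1) n).unop ψ) m) : m = 0 := by
  obtain ⟨c, h1, h2⟩ := h
  have hinj : Function.Injective (K.pOpcycles (n+1)).unop := by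
    rw [← ModuleCat.mono_iff_injective]; infer_instance
  have : c = (K.fromOpcycles (n+1) n).unop ψ := by
    apply hinj
    rw [h2, ← ModuleCat.comp_apply, ← unop_comp, HomologicalComplex.p_fromOpcycles]
  rw [← h1, this, ← ModuleCat.comp_apply, ← unop_comp, HomologicalComplex.homologyι_comp_fromOpcycles]
  rfl

/-- The complex computing `Ext`. -/
abbrev extCx {X : ModuleCat.{0} R} (P : ProjectiveResolution X) (Y : ModuleCat.{0} R) :
    ChainComplex (ModuleCat.{0} R)ᵒᵖ ℕ :=
  ((((linearYoneda R (ModuleCat.{0} R)).obj Y).rightOp).mapHomologicalComplex _).obj P.complex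

/-- The comparison map. -/
def extCmp {X : ModuleCat.{0} R} (P : ProjectiveResolution X) (Y : ModuleCat.{0} R) (n : ℕ) :
    ((Ext R (ModuleCat.{0} R) n).obj (op X)).obj Y ≅ ((extCx P Y).homology n).unop :=
  (P.isoLeftDerivedObj ((linearYoneda R (ModuleCat.{0} R)).obj Y).rightOp n).unop.symm

/-- A cocycle `φ` represents a class `m` in (derived functor) `Ext`. -/
def ExtRep {X Y : ModuleCat.{0} R} (P : ProjectiveResolution X) (n : ℕ) (φ : P.complex.X n ⟶ Y)
    (m : ((Ext R (ModuleCat.{0} R) n).obj (op X)).obj Y) : Prop :=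
  UnRep (extCx P Y) n φ ((extCmp P Y n).hom m)

variable {X Y : ModuleCat.{0} R} (P : ProjectiveResolution X)

lemma ExtRep.exists (n : ℕ) (m : ((Ext R (ModuleCat.{0} R) n).obj (op X)).obj Y) :
    ∃ φ, ExtRep P n φ m := UnRep.exists (extCx P Y) n ((extCmp P Y n).hom m)

variable {P}

lemma ExtRep.smul {n : ℕ} {φ : P.complex.X n ⟶ Y}
    {m : ((Ext R (ModuleCat.{0} R) n).obj (op X)).obj Y} (h : ExtRep P n φ m) (r : R) :
    ExtRep P n (r • φ) (r • m) := by
  have := UnRep.smul (K := extCx P Y) h r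
  have e : (extCmp P Y n).hom (r • m) = r • (extCmp P Y n).hom m := map_smul _ _ _
  have key : UnRep (extCx P Y) n (r • φ) ((extCmp P Y n).hom (r • m)) := e ▸ this
  exact key

lemma ExtRep.map {X' : ModuleCat.{0} R} {P' : ProjectiveResolution X'} {g : X' ⟶ X}
    (f : ProjectiveResolution.Hom P' P g)
    {n : ℕ} {φ : P.complex.X n ⟶ Y}
    {m : ((Ext R (ModuleCat.{0} R) n).obj (op X)).obj Y} (h : ExtRep P n φ m) :
    ExtRep P' n (f.hom.f n ≫ φ) (((Ext R (ModuleCat.{0} R) n).map g.op).app Y m) := by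
  have := UnRep.map (K := extCx P' Y) (L := extCx P Y)
    ((((linearYoneda R (ModuleCat.{0} R)).obj Y).rightOp.mapHomologicalComplex _).map f.hom) h
  have nat := ProjectiveResolution.isoLeftDerivedObj_inv_naturality g P' P f.hom
    (by simpa using f.hom_f_zero_comp_π_f_zero) ((linearYoneda R (ModuleCat.{0} R)).obj Y).rightOp n
  have nat' := ConcreteCategory.congr_hom (congrArg Quiver.Hom.unop nat) m
  have e : (extCmp P' Y n).hom (((Ext R (ModuleCat.{0} R) n).map g.op).app Y m) =
    (HomologicalComplex.homologyMap ((((linearYoneda R (ModuleCat.{0} R)).obj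
      Y).rightOp.mapHomologicalComplex _).map f.hom) n).unop ((extCmp P Y n).hom m) := nat'
  have key : UnRep (extCx P' Y) n (f.hom.f n ≫ φ)
      ((extCmp P' Y n).hom (((Ext R (ModuleCat.{0} R) n).map g.op).app Y m)) := by
    rw [e]; exact this
  exact key

lemma ExtRep.closed {n : ℕ} {φ : P.complex.X n ⟶ Y}
    {m : ((Ext R (ModuleCat.{0} R) n).obj (op X)).obj Y} (h : ExtRep P n φ m) (i : ℕ) :
    P.complex.d i n ≫ φ = 0 := UnRep.closed (K := extCx P Y) h i

lemma ExtRep.zero {n : ℕ} {φ : P.complex.X (n+1) ⟶ Y}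
    (h : ExtRep P (n+1) φ 0) : ∃ ψ : P.complex.X n ⟶ Y, P.complex.d (n+1) n ≫ ψ = φ := by
  have e : (extCmp P Y (n+1)).hom 0 = 0 := map_zero _
  have h' : UnRep (extCx P Y) (n+1) φ 0 := e ▸ h
  exact UnRep.zero h'

lemma ExtRep.eq_zero {n : ℕ} {ψ : P.complex.X n ⟶ Y}
    {m : ((Ext R (ModuleCat.{0} R) (n+1)).obj (op X)).obj Y}
    (h : ExtRep P (n+1) (P.complex.d (n+1) n ≫ ψ) m) : m = 0 := by
  have := UnRep.eq_zero (K := extCx P Y) (ψ := ψ) (m := (extCmp P Y (n+1)).hom m) h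
  have hinj : Function.Injective (extCmp P Y (n+1)).hom := by
    rw [← ModuleCat.mono_iff_injective]; infer_instance
  apply hinj
  rw [this, map_zero]

/-- Transfer of a vanishing statement from Yoneda `Ext` to derived functor `Ext`. -/
lemma ext_transfer {X X' Y : ModuleCat.{0} R} (g : X' ⟶ X) (n : ℕ) (r : R)
    (H : ∀ α : Abelian.Ext.{0} X Y (n+1), r • α = 0 →
      (Abelian.Ext.mk₀ g).comp α (zero_add _) = 0)
    (m : ((Ext R (ModuleCat.{0} R) (n+1)).obj (op X)).obj Y) (hm : r • m = 0) :
    ((Ext R (ModuleCat.{0} R) (n+1)).map g.op).app Y m = 0 := by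
  let P := projectiveResolution X
  let P' := projectiveResolution X'
  let f : ProjectiveResolution.Hom P' P g := ⟨ProjectiveResolution.lift g P' P, by
    simpa using ProjectiveResolution.lift_commutes_zero g P' P⟩
  obtain ⟨φ, hφ⟩ := ExtRep.exists P (n+1) m
  have hc := hφ.closed (n+1+1)
  have h0 := hφ.smul r
  rw [hm] at h0
  obtain ⟨ψ, hψ⟩ := h0.zero
  have hα : r • P.extMk φ _ rfl hc = 0 := by
    rw [Abelian.Ext.smul_eq_comp_mk₀, ProjectiveResolution.extMk_comp_mk₀,
      ProjectiveResolution.extMk_eq_zero_iff _ _ _ _ _ n rfl]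
    exact ⟨ψ, by simpa using hψ⟩
  have h1 := H _ hα
  rw [ProjectiveResolution.mk₀_comp_extMk _ _ _ _ f,
    ProjectiveResolution.extMk_eq_zero_iff _ _ _ _ _ n rfl] at h1
  obtain ⟨ψ', hψ'⟩ := h1
  have h2 := hφ.map f
  rw [← hψ'] at h2
  exact h2.eq_zero
end Bridge

section ExtArg
open CategoryTheory Opposite Limits
variable {R : Type} [CommRing R]

/-- Exactness of `0 → A → A → B → 0`, where the first map is multiplication by `r`. -/
structure IsSES {A B : ModuleCat.{0} R} (r : R) (π : A ⟶ B) : Prop where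
  w : (r • 𝟙 A) ≫ π = 0
  ex : (ShortComplex.mk (r • 𝟙 A) π w).ShortExact

lemma IsSES.of {A B : ModuleCat.{0} R} {r : R} {π : A ⟶ B}
    (inj : ∀ x : A, r • x = 0 → x = 0) (surj : Function.Surjective π)
    (ker : ∀ x : A, π x = 0 → ∃ y, r • y = x) (w : ∀ x : A, π (r • x) = 0) : IsSES r π := by
  have w' : (r • 𝟙 A) ≫ π = 0 := by
    ext x; exact w x
  refine ⟨w', ?_⟩
  have hmono : Mono (r • 𝟙 A) := by
    rw [ModuleCat.mono_iff_injective]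
    intro x y hxy
    rw [← sub_eq_zero]
    apply inj
    rw [smul_sub, sub_eq_zero]
    exact hxy
  have hepi : Epi π := by rwa [ModuleCat.epi_iff_surjective]
  refine { exact := ?_, mono_f := hmono, epi_g := hepi }
  rw [ShortComplex.moduleCat_exact_iff]
  intro x hx
  obtain ⟨y, hy⟩ := ker x hx
  exact ⟨y, hy⟩

/-- the connecting class -/
noncomputable def IsSES.δ {A B : ModuleCat.{0} R} {r : R} {π : A ⟶ B} (h : IsSES r π) :
    Abelian.Ext.{0} B A 1 := h.ex.extClass

lemma IsSES.lift {A B : ModuleCat.{0} R} {r : R} {π : A ⟶ B} (h : IsSES r π) {X : ModuleCat.{0} R}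
    {n : ℕ} (e : Abelian.Ext.{0} X A (n+1)) (he : r • e = 0) :
    ∃ e' : Abelian.Ext.{0} X B n, e'.comp h.δ rfl = e := by
  apply Abelian.Ext.covariant_sequence_exact₁ X h.ex e
  rwa [← Abelian.Ext.smul_eq_comp_mk₀]

lemma IsSES.comp_δ {A B : ModuleCat.{0} R} {r : R} {π : A ⟶ B} (h : IsSES r π) :
    (Abelian.Ext.mk₀ π).comp h.δ (zero_add 1) = 0 := h.ex.comp_extClass

lemma IsSES.nat {A B A' B' : ModuleCat.{0} R} {r r' : R} {π : A ⟶ B} {π' : A' ⟶ B'} (h : IsSES r π)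
    (h' : IsSES r' π') (s : R) (hr : r' = r * s) (a : A ⟶ A') (b : B ⟶ B')
    (hab : π ≫ b = (s • a) ≫ π') :
    h.δ.comp (Abelian.Ext.mk₀ a) (add_zero 1) = (Abelian.Ext.mk₀ b).comp h'.δ (zero_add 1) := by
  let f : (ShortComplex.mk (r • 𝟙 A) π h.w) ⟶ (ShortComplex.mk (r' • 𝟙 A') π' h'.w) :=
    { τ₁ := a, τ₂ := s • a, τ₃ := b
      comm₁₂ := by simp [hr, smul_smul, mul_comm]
      comm₂₃ := by simpa using hab.symm }
  exact ShortComplex.ShortExact.extClass_naturality h.ex h'.ex f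

lemma ext_kill {X Y : ModuleCat.{0} R} {r : R} (hr : r • 𝟙 X = 0) {n : ℕ}
    (e : Abelian.Ext.{0} X Y n) : r • e = 0 := by
  have : r • e = (Abelian.Ext.mk₀ (r • 𝟙 X)).comp e (zero_add n) := by
    rw [Abelian.Ext.mk₀_smul, Abelian.Ext.smul_comp, Abelian.Ext.mk₀_id_comp]
  rw [this, hr, Abelian.Ext.mk₀_zero, Abelian.Ext.zero_comp]

open Abelian in
lemma ext_main {X X' A Ap Apf Apfg Apf' Apfg' Af' Afg' : ModuleCat.{0} R} (k : X' ⟶ X)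
    {p f g f1 g1 : R} {π0 : A ⟶ Ap} {πf : Ap ⟶ Apf} {πg : Apf ⟶ Apfg}
    {πf' : Ap ⟶ Apf'} {πg' : Apf' ⟶ Apfg'} {ωf : A ⟶ Af'} {ωg : Af' ⟶ Afg'}
    (s0 : IsSES p π0) (sf : IsSES f πf) (sg : IsSES g πg)
    (sf' : IsSES (f * f1) πf') (sg' : IsSES (g * g1) πg')
    (tf : IsSES (f * f1) ωf) (tg : IsSES (g * g1) ωg)
    (σ1 : Apf ⟶ Apf') (hσ1 : πf ≫ σ1 = f1 • πf')
    (σ2 : Apfg ⟶ Apfg') (hσ2 : πg ≫ σ2 = (g1 • σ1) ≫ πg')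
    (ρ1 : Af' ⟶ Apf') (hρ1 : ωf ≫ ρ1 = π0 ≫ πf')
    (ρ2 : Afg' ⟶ Apfg') (hρ2 : ωg ≫ ρ2 = ρ1 ≫ πg')
    (hf : f • 𝟙 X = 0) (hg : g • 𝟙 X = 0)
    (key : ∀ h : X ⟶ Apfg, ∃ h' : X' ⟶ Afg', k ≫ h ≫ σ2 = h' ≫ ρ2)
    (m : Ext.{0} X A 3) (hm : p • m = 0) : (Ext.mk₀ k).comp m (zero_add 3) = 0 := by
  obtain ⟨e, rfl⟩ := s0.lift m hm
  obtain ⟨e, rfl⟩ := sf.lift e (ext_kill hf e)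
  obtain ⟨e, rfl⟩ := sg.lift e (ext_kill hg e)
  obtain ⟨h, rfl⟩ := (Ext.mk₀_bijective _ _).2 e
  obtain ⟨h', hh'⟩ := key h
  have n1 : sf.δ = (Ext.mk₀ σ1).comp sf'.δ (zero_add 1) := by
    have := sf.nat sf' f1 rfl (𝟙 _) σ1 (by simpa using hσ1)
    simpa using this
  have n2 := sg.nat sg' g1 rfl σ1 σ2 hσ2
  have n3 := tf.nat sf' 1 (by simp) π0 ρ1 (by simpa using hρ1)
  have n4 := tg.nat sg' 1 (by simp) ρ1 ρ2 (by simpa using hρ2)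
  -- the composite of the first two connecting classes
  have c1 : ((Ext.mk₀ h).comp sg.δ (zero_add 1)).comp sf.δ (rfl : 1 + 1 = 2) =
      ((Ext.mk₀ (h ≫ σ2)).comp sg'.δ (zero_add 1)).comp sf'.δ (rfl : 1 + 1 = 2) := by
    rw [n1, ← Ext.comp_assoc (a₁₂ := 1) _ _ _ (by lia) (by lia) (by lia),
      Ext.comp_assoc (a₂₃ := 1) (Ext.mk₀ h) sg.δ (Ext.mk₀ σ1) (by lia) (by lia) (by lia), n2,
      ← Ext.comp_assoc (a₁₂ := 0) (Ext.mk₀ h) (Ext.mk₀ σ2) sg'.δ (by lia) (by lia) (by lia),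
      Ext.mk₀_comp_mk₀]
  have c2 : (Ext.mk₀ k).comp (((Ext.mk₀ h).comp sg.δ (zero_add 1)).comp sf.δ (rfl : 1 + 1 = 2))
      (zero_add 2) =
      ((Ext.mk₀ (h' ≫ ρ2)).comp sg'.δ (zero_add 1)).comp sf'.δ (rfl : 1 + 1 = 2) := by
    rw [c1, ← Ext.comp_assoc (a₁₂ := 1) _ _ _ (by lia) (by lia) (by lia),
      ← Ext.comp_assoc (a₁₂ := 0) _ _ _ (by lia) (by lia) (by lia), Ext.mk₀_comp_mk₀, hh']
  have c3 : ((Ext.mk₀ (h' ≫ ρ2)).comp sg'.δ (zero_add 1)).comp sf'.δ (rfl : 1 + 1 = 2) =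
      (((Ext.mk₀ h').comp tg.δ (zero_add 1)).comp tf.δ (rfl : 1 + 1 = 2)).comp (Ext.mk₀ π0)
        (add_zero 2) := by
    rw [← Ext.mk₀_comp_mk₀,
      Ext.comp_assoc (a₂₃ := 1) (Ext.mk₀ h') (Ext.mk₀ ρ2) sg'.δ (by lia) (by lia) (by lia), ← n4,
      ← Ext.comp_assoc (a₁₂ := 1) (Ext.mk₀ h') tg.δ (Ext.mk₀ ρ1) (by lia) (by lia) (by lia),
      Ext.comp_assoc (a₂₃ := 1) _ (Ext.mk₀ ρ1) sf'.δ (by lia) (by lia) (by lia), ← n3,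
      ← Ext.comp_assoc (a₁₂ := 2) _ _ _ (by lia) (by lia) (by lia)]
  rw [← Ext.comp_assoc (a₁₂ := 2) _ _ _ (by lia) (by lia) (by lia), c2, c3,
    Ext.comp_assoc (a₂₃ := 1) _ _ _ (by lia) (by lia) (by lia), s0.comp_δ, Ext.comp_zero]

/-- multiplication by `c` from `R/a` to `R/b`. -/
def mulQ (a b : Ideal R) (c : R) (h : ∀ x ∈ a, c * x ∈ b) :
    ModuleCat.of R (R ⧸ a) ⟶ ModuleCat.of R (R ⧸ b) :=
  ModuleCat.ofHom (Submodule.mapQ a b (c • LinearMap.id)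
    (fun x hx => by rw [Submodule.mem_comap]; exact h x hx))

lemma mulQ_apply (a b : Ideal R) (c : R) (h : ∀ x ∈ a, c * x ∈ b) (x : R) :
    mulQ a b c h (Submodule.Quotient.mk x : R ⧸ a) = (Submodule.Quotient.mk (c * x) : R ⧸ b) := rfl

lemma ses_quot (a b : Ideal R) (r : R) (hb : b = a ⊔ Ideal.span {r})
    (hr : ∀ x, r * x ∈ a → x ∈ a) (h) : IsSES r (mulQ a b 1 h) := by
  subst hb
  apply IsSES.of
  · intro x
    obtain ⟨x, rfl⟩ := Submodule.Quotient.mk_surjective a x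
    intro hx
    change (Submodule.Quotient.mk (r * x) : R ⧸ a) = 0 at hx
    rw [Submodule.Quotient.mk_eq_zero] at hx ⊢
    exact hr x hx
  · intro x
    obtain ⟨x, rfl⟩ := Submodule.Quotient.mk_surjective _ x
    exact ⟨Submodule.Quotient.mk x, by rw [mulQ_apply, one_mul]⟩
  · intro x
    obtain ⟨x, rfl⟩ := Submodule.Quotient.mk_surjective a x
    intro hx
    rw [mulQ_apply, Submodule.Quotient.mk_eq_zero, one_mul] at hx
    obtain ⟨y, hy, z, hz, rfl⟩ := Submodule.mem_sup.mp hx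
    obtain ⟨w, rfl⟩ := Ideal.mem_span_singleton.mp hz
    refine ⟨Submodule.Quotient.mk w, ?_⟩
    change (Submodule.Quotient.mk (r * w) : R ⧸ a) = _
    rw [Submodule.Quotient.eq]
    convert a.neg_mem hy using 1
    ring
  · intro x
    obtain ⟨x, rfl⟩ := Submodule.Quotient.mk_surjective a x
    change mulQ _ _ _ _ (Submodule.Quotient.mk (r * x) : R ⧸ a) = _
    rw [mulQ_apply, Submodule.Quotient.mk_eq_zero, one_mul]
    exact Ideal.mem_sup_right (Ideal.mem_span_singleton.mpr (dvd_mul_right _ _))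

lemma ses_base (r : R) (hr : ∀ x, r * x = 0 → x = 0) :
    IsSES (A := ModuleCat.of R R) r (ModuleCat.ofHom (Submodule.mkQ (Ideal.span {r}))) := by
  apply IsSES.of
  · exact hr
  · exact Submodule.mkQ_surjective _
  · intro x hx
    change (Submodule.Quotient.mk x : R ⧸ Ideal.span {r}) = 0 at hx
    rw [Submodule.Quotient.mk_eq_zero] at hx
    obtain ⟨w, rfl⟩ := Ideal.mem_span_singleton.mp hx
    exact ⟨w, rfl⟩
  · intro x
    change (Submodule.Quotient.mk (r * x) : R ⧸ Ideal.span {r}) = 0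
    rw [Submodule.Quotient.mk_eq_zero]
    exact Ideal.mem_span_singleton.mpr (dvd_mul_right _ _)

lemma hom_quot_ext {a : Ideal R} {B : ModuleCat.{0} R} {φ ψ : ModuleCat.of R (R ⧸ a) ⟶ B}
    (h : φ (Submodule.Quotient.mk 1 : R ⧸ a) = ψ (Submodule.Quotient.mk 1 : R ⧸ a)) : φ = ψ := by
  apply ModuleCat.hom_ext
  apply Submodule.linearMap_qext
  apply LinearMap.ext_ring
  exact h

lemma ext_ideal {J J' : Ideal R} (hJ : J' ≤ J) (p f g f1 g1 : R) (hfJ : f ∈ J) (hgJ : g ∈ J)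
    (h0 : ∀ x, p * x = 0 → x = 0)
    (hf : ∀ x, f * x ∈ Ideal.span {p} → x ∈ Ideal.span {p})
    (hg : ∀ x, g * x ∈ Ideal.span {p} ⊔ Ideal.span {f} → x ∈ Ideal.span {p} ⊔ Ideal.span {f})
    (hf' : ∀ x, (f * f1) * x ∈ Ideal.span {p} → x ∈ Ideal.span {p})
    (hg' : ∀ x, (g * g1) * x ∈ Ideal.span {p} ⊔ Ideal.span {f * f1} →
      x ∈ Ideal.span {p} ⊔ Ideal.span {f * f1})
    (tf : ∀ x, (f * f1) * x = 0 → x = 0)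
    (tg : ∀ x, (g * g1) * x ∈ Ideal.span {f * f1} → x ∈ Ideal.span {f * f1})
    (key : ∀ b, (∀ j ∈ J, j * b ∈ Ideal.span {p} ⊔ Ideal.span {f} ⊔ Ideal.span {g}) →
      ∃ b', (∀ j ∈ J', j * b' ∈ Ideal.span {f * f1} ⊔ Ideal.span {g * g1}) ∧
        f1 * g1 * b - b' ∈ Ideal.span {p})
    (m : Abelian.Ext.{0} (ModuleCat.of R (R ⧸ J)) (ModuleCat.of R R) 3) (hm : p • m = 0) :
    (Abelian.Ext.mk₀ (ModuleCat.ofHom (Submodule.mapQ J' J LinearMap.id hJ))).comp m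
      (zero_add 3) = 0 := by
  have i1 : ∀ x ∈ Ideal.span {p} ⊔ Ideal.span {f}, f1 * x ∈ Ideal.span {p} ⊔ Ideal.span {f * f1} := by
    intro x hx
    obtain ⟨y, hy, z, hz, rfl⟩ := Submodule.mem_sup.mp hx
    obtain ⟨w, rfl⟩ := Ideal.mem_span_singleton.mp hz
    rw [mul_add]
    refine Submodule.add_mem_sup (Ideal.mul_mem_left _ _ hy) ?_
    exact Ideal.mem_span_singleton.mpr ⟨w, by ring⟩
  have i2 : ∀ x ∈ Ideal.span {p} ⊔ Ideal.span {f} ⊔ Ideal.span {g}, (f1 * g1) * x ∈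
      Ideal.span {p} ⊔ Ideal.span {f * f1} ⊔ Ideal.span {g * g1} := by
    intro x hx
    obtain ⟨y, hy, z, hz, rfl⟩ := Submodule.mem_sup.mp hx
    obtain ⟨w, rfl⟩ := Ideal.mem_span_singleton.mp hz
    rw [mul_add]
    refine Submodule.add_mem_sup ?_ ?_
    · rw [mul_comm f1, mul_assoc]
      exact Ideal.mul_mem_left _ _ (i1 y hy)
    exact Ideal.mem_span_singleton.mpr ⟨w * f1, by ring⟩
  have incl : ∀ (a b : Ideal R), a ≤ b → ∀ x ∈ a, 1 * x ∈ b := fun a b h x hx => by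
    rw [one_mul]; exact h hx
  have l1 : Ideal.span {f * f1} ≤ Ideal.span {p} ⊔ Ideal.span {f * f1} := le_sup_right
  have l2 : Ideal.span {f * f1} ⊔ Ideal.span {g * g1} ≤
      Ideal.span {p} ⊔ Ideal.span {f * f1} ⊔ Ideal.span {g * g1} := sup_le_sup l1 le_rfl
  have kill : ∀ r ∈ J, r • 𝟙 (ModuleCat.of R (R ⧸ J)) = 0 := by
    intro r hr
    apply hom_quot_ext
    change (Submodule.Quotient.mk (r * 1) : R ⧸ J) = 0
    rw [Submodule.Quotient.mk_eq_zero]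
    exact Ideal.mul_mem_right _ _ hr
  refine ext_main _ (ses_base p h0)
    (ses_quot _ _ f rfl hf (incl _ _ le_sup_left)) (ses_quot _ _ g rfl hg (incl _ _ le_sup_left))
    (ses_quot _ _ (f * f1) rfl hf' (incl _ _ le_sup_left))
    (ses_quot _ _ (g * g1) rfl hg' (incl _ _ le_sup_left))
    (ses_base (f * f1) tf) (ses_quot _ _ (g * g1) rfl tg (incl _ _ le_sup_left))
    (mulQ _ _ f1 i1) ?_ (mulQ _ _ (f1 * g1) i2) ?_ (mulQ _ _ 1 (incl _ _ l1)) ?_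
    (mulQ _ _ 1 (incl _ _ l2)) ?_ (kill f hfJ) (kill g hgJ) ?_ m hm
  · apply hom_quot_ext
    change (Submodule.Quotient.mk _ : R ⧸ _) = Submodule.Quotient.mk _
    congr 1
  · apply hom_quot_ext
    change (Submodule.Quotient.mk (f1 * g1 * (1 * 1)) : R ⧸ _) =
      Submodule.Quotient.mk (1 * (g1 * (f1 * 1)))
    congr 1
    ring
  · apply ModuleCat.hom_ext
    apply LinearMap.ext_ring
    change (Submodule.Quotient.mk (1 * 1) : R ⧸ _) = Submodule.Quotient.mk (1 * 1)
    rfl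
  · apply hom_quot_ext
    change (Submodule.Quotient.mk _ : R ⧸ _) = Submodule.Quotient.mk _
    rfl
  · intro h
    obtain ⟨b, hb⟩ := Submodule.Quotient.mk_surjective _ (h (Submodule.Quotient.mk 1 : R ⧸ J))
    obtain ⟨b', hb', hbb⟩ := key b (by
      intro j hj
      have e : h (j • (Submodule.Quotient.mk 1 : R ⧸ J)) = j • h (Submodule.Quotient.mk 1 : R ⧸ J) :=
        map_smul h.hom _ _
      have e2 : j • (Submodule.Quotient.mk 1 : R ⧸ J) = 0 := by
        change (Submodule.Quotient.mk (j * 1) : R ⧸ J) = 0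
        rw [Submodule.Quotient.mk_eq_zero]
        exact Ideal.mul_mem_right _ _ hj
      rw [e2, ← hb] at e
      have e3 : h (0 : R ⧸ J) = 0 := map_zero h.hom
      rw [e3] at e
      change 0 = (Submodule.Quotient.mk (j * b) : R ⧸ _) at e
      exact (Submodule.Quotient.mk_eq_zero _).mp e.symm)
    refine ⟨mulQ _ _ b' (fun x hx => by rw [mul_comm b' x]; exact hb' x hx), ?_⟩
    apply hom_quot_ext
    change mulQ _ _ (f1 * g1) i2 (h (Submodule.Quotient.mk 1 : R ⧸ J)) =
      (Submodule.Quotient.mk (1 * (b' * 1)) : R ⧸ _)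
    rw [← hb, mulQ_apply, Submodule.Quotient.eq, one_mul, mul_one]
    exact Ideal.mem_sup_left (Ideal.mem_sup_left hbb)
end ExtArg

namespace Polynomial.Idt
open Finset

def A {R : Type*} [CommRing R] (m n : ℕ) (d y : R) : R :=
  ∑ i ∈ range (n+1), ((m+i).choose m : R) * y^i * d^(n-i)

lemma A_succ {R : Type*} [CommRing R] (m n : ℕ) (d y : R) :
    A m (n+1) d y = d * A m n d y + ((m+(n+1)).choose m : R) * y^(n+1) := by
  unfold A
  rw [sum_range_succ, mul_sum]
  simp only [Nat.sub_self, pow_zero, mul_one]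
  congr 1
  apply sum_congr rfl
  intro i hi
  have : n + 1 - i = (n - i) + 1 := by have := mem_range.mp hi; lia
  rw [this, pow_succ]; ring

lemma A_rec {R : Type*} [CommRing R] (m n : ℕ) (d y : R) :
    (d - y) * A (m+1) n d y = d * A m n d y - ((m+1+n).choose (m+1) : R) * y^(n+1) := by
  induction n with
  | zero => simp [A]
  | succ n ih =>
    rw [A_succ, A_succ, mul_add, mul_left_comm, ih]
    have h : ((m + 1 + (n+1)).choose (m+1)) = (m + (n+1)).choose m + (m+1+n).choose (m+1) := by
      rw [show m + 1 + (n+1) = (m + (n+1)) + 1 by ring, Nat.choose_succ_succ,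
        show m + 1 + n = m + (n+1) by ring]
    rw [h]; push_cast; ring

lemma A_dvd {R : Type*} [CommRing R] (m n : ℕ) (d y : R) :
    y^(n+1) ∣ d^(m+n+1) - (d-y)^(m+1) * A m n d y := by
  induction m with
  | zero =>
    have h : (d - y) * A 0 n d y = d^(n+1) - y^(n+1) := by
      induction n with
      | zero => simp [A]
      | succ n ih => rw [A_succ, mul_add, mul_left_comm, ih]; simp; ring
    rw [zero_add, zero_add, pow_one, h]; simp
  | succ m ih =>
    have h : d^(m+1+n+1) - (d-y)^(m+1+1) * A (m+1) n d y =
      d * (d^(m+n+1) - (d-y)^(m+1) * A m n d y) +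
        y^(n+1) * ((d-y)^(m+1) * ((m+1+n).choose (m+1) : R)) := by
      rw [pow_succ (d-y) (m+1), mul_assoc, A_rec]; ring
    rw [h]
    exact dvd_add (Dvd.dvd.mul_left ih _) (dvd_mul_right _ _)



lemma coeff_modQ {K : Type*} [Field K] (a : K) (k : ℕ) (g : K[X]) :
    (g %ₘ (X - C a)^(k+1)).coeff k = (taylor a g).coeff k := by
  have hm : ((X - C a)^(k+1)).Monic := (monic_X_sub_C a).pow _
  conv_rhs => rw [← modByMonic_add_div g ((X - C a)^(k+1))]
  rw [map_add, taylor_mul]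
  have h1 : taylor a ((X - C a)^(k+1)) = X^(k+1) := by
    rw [taylor_pow]; simp
  rw [h1, coeff_add, coeff_X_pow_mul']
  simp only [show ¬ (k+1 ≤ k) by lia, if_false, add_zero]
  set r := g %ₘ (X - C a)^(k+1)
  have hr : r.natDegree ≤ k := by
    have h := natDegree_modByMonic_lt g hm (by
      intro h; have := congrArg natDegree h; simp [natDegree_pow] at this)
    simp [natDegree_pow] at h
    lia
  rcases hr.eq_or_lt with h | h
  · have := coeff_taylor_natDegree (r := a) (f := r)
    rw [h] at this
    rw [this, leadingCoeff, h]
  · rw [coeff_eq_zero_of_natDegree_lt h, coeff_eq_zero_of_natDegree_lt (by rwa [natDegree_taylor])]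

/-- residue -/
noncomputable def rho {K : Type*} [Field K] (k : ℕ) (a b c : K) : K :=
  (taylor a (X^k * A k k (C (a-b)) (C a - X) * A k k (C (a - c)) (C a - X))).coeff k

lemma modQ_dvd {K : Type*} [Field K] (k : ℕ) (a b c : K) :
    (X - C a)^(k+1) ∣ C ((a-b)^(2*k+1)*(a-c)^(2*k+1)) * X^k -
      (X - C b)^(k+1) * (X - C c)^(k+1) *
       ((X^k * A k k (C (a-b)) (C a - X) * A k k (C (a - c)) (C a - X)) %ₘ (X - C a)^(k+1)) := by
  set g := (X^k * A k k (C (a-b)) (C a - X) * A k k (C (a - c)) (C a - X)) with hg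
  have hm := modByMonic_add_div g ((X - C a)^(k+1))
  have hb := A_dvd k k (C (a-b)) (C a - X)
  have hc := A_dvd k k (C (a-c)) (C a - X)
  have e : ∀ b, C (a-b) - (C a - X) = X - C b := by intro b; rw [C_sub]; ring
  rw [e] at hb hc
  have hn : (X - C a)^(k+1) ∣ (C a - X)^(k+1) := pow_dvd_pow_of_dvd ⟨-1, by ring⟩ _
  obtain ⟨s, hs⟩ := hn.trans hb
  obtain ⟨t, ht⟩ := hn.trans hc
  rw [show k + k + 1 = 2*k+1 by ring] at hs ht
  rw [C_mul, C_pow, C_pow, eq_add_of_sub_eq hs, eq_add_of_sub_eq ht, eq_sub_of_add_eq hm]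
  set P := (X - C a)^(k+1)
  set h := g /ₘ P
  rw [hg]
  generalize A k k (C (a-b)) (C a - X) = A1
  generalize A k k (C (a-c)) (C a - X) = A2
  refine ⟨s * (P * t + (X - C c)^(k+1) * A2) * X^k + (X - C b)^(k+1) * A1 * t * X^k
    + (X - C b)^(k+1) * (X - C c)^(k+1) * h, ?_⟩
  ring

lemma res_sum {K : Type*} [Field K] (k : ℕ) (a b c : K) (hab : a ≠ b) (hbc : b ≠ c) (hca : c ≠ a) :
    (b-c)^(2*k+1) * rho k a b c + (c-a)^(2*k+1) * rho k b c a + (a-b)^(2*k+1) * rho k c a b = 0 := by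
  set G : K → K → K → K[X] := fun a b c =>
    X^k * A k k (C (a-b)) (C a - X) * A k k (C (a - c)) (C a - X) with hG
  set M : K → K → K → K[X] := fun a b c => G a b c %ₘ (X - C a)^(k+1) with hM
  have hr : ∀ a b c, rho k a b c = (M a b c).coeff k := fun a b c => (coeff_modQ _ _ _).symm
  have hd : ∀ a b c, (M a b c).natDegree ≤ k := by
    intro a b c
    have h := natDegree_modByMonic_lt (G a b c) ((monic_X_sub_C a).pow (k+1)) (by
      intro h; have := congrArg natDegree h; simp [natDegree_pow] at this)
    simp [natDegree_pow] at h
    simp only [hM]; lia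
  have hQ : ∀ a : K, ((X - C a)^(k+1)).natDegree = k+1 := by intro a; simp [natDegree_pow]
  have hQm : ∀ a : K, ((X - C a)^(k+1)).Monic := fun a => (monic_X_sub_C a).pow _
  have hQc : ∀ a : K, ((X - C a)^(k+1)).coeff (k+1) = 1 := fun a => by
    have := (hQm a).coeff_natDegree; rwa [hQ] at this
  -- the polynomial
  set N : K := -((a-b)^(2*k+1)*(b-c)^(2*k+1)*(c-a)^(2*k+1)) with hN
  set S : K → K → K → K[X] := fun a b c => C ((b-c)^(2*k+1)) *
    ((X - C b)^(k+1) * (X - C c)^(k+1) * M a b c) with hS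
  have odd : Odd (2*k+1) := ⟨k, rfl⟩
  have h1 : ∀ a b c, (X - C a)^(k+1) ∣
      C (-((a-b)^(2*k+1)*(b-c)^(2*k+1)*(c-a)^(2*k+1))) * X^k - S a b c := by
    intro a b c
    obtain ⟨t, ht⟩ := modQ_dvd k a b c
    refine ⟨C ((b-c)^(2*k+1)) * t, ?_⟩
    rw [mul_left_comm, ← ht]
    simp only [hS, hM, hG]
    rw [show (a - c)^(2*k+1) = -(c-a)^(2*k+1) by rw [← odd.neg_pow, neg_sub]]
    simp only [C_mul, C_neg, C_pow]
    ring
  have dS1 : ∀ a b c, (X - C b)^(k+1) ∣ S a b c := fun a b c =>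
    ⟨C ((b-c)^(2*k+1)) * ((X - C c)^(k+1) * M a b c), by simp only [hS]; ring⟩
  have dS2 : ∀ a b c, (X - C c)^(k+1) ∣ S a b c := fun a b c =>
    ⟨C ((b-c)^(2*k+1)) * ((X - C b)^(k+1) * M a b c), by simp only [hS]; ring⟩
  have dSd : ∀ a b c, (S a b c).natDegree ≤ 3*k+2 := by
    intro a b c
    refine (natDegree_C_mul_le _ _).trans (natDegree_mul_le.trans ?_)
    have := natDegree_mul_le (p := (X - C b)^(k+1)) (q := (X - C c)^(k+1))
    rw [hQ, hQ] at this
    have := hd a b c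
    lia
  have cS : ∀ a b c, (S a b c).coeff (3*k+2) = (b-c)^(2*k+1) * rho k a b c := by
    intro a b c
    simp only [hS]
    rw [coeff_C_mul, show 3*k+2 = ((k+1)+(k+1)) + k by ring,
      coeff_mul_add_eq_of_natDegree_le _ (hd a b c), coeff_mul_add_eq_of_natDegree_le (hQ b).le (hQ c).le,
      hQc, hQc, one_mul, one_mul, hr]
    refine natDegree_mul_le.trans ?_
    rw [hQ, hQ]
  set Φ := C N * X^k - S a b c - S b c a - S c a b with hΦ
  have g1 : (X - C a)^(k+1) ∣ Φ := dvd_sub (dvd_sub (h1 a b c) (dS2 b c a)) (dS1 c a b)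
  have g2 : (X - C b)^(k+1) ∣ Φ := by
    have h := dvd_sub (dvd_sub (h1 b c a) (dS1 a b c)) (dS2 c a b)
    convert h using 1
    rw [hΦ, hN, show (b - c)^(2*k+1) * (c-a)^(2*k+1)*(a-b)^(2*k+1) =
      (a-b)^(2*k+1)*(b-c)^(2*k+1)*(c-a)^(2*k+1) by ring]
    ring
  have g3 : (X - C c)^(k+1) ∣ Φ := by
    have h := dvd_sub (dvd_sub (h1 c a b) (dS2 a b c)) (dS1 b c a)
    convert h using 1
    rw [hΦ, hN, show (c-a)^(2*k+1)*(a-b)^(2*k+1) * (b - c)^(2*k+1) =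
      (a-b)^(2*k+1)*(b-c)^(2*k+1)*(c-a)^(2*k+1) by ring]
    ring
  have cop : ∀ a b : K, a ≠ b → IsCoprime ((X - C a)^(k+1)) ((X - C b)^(k+1)) := fun a b h =>
    (isCoprime_X_sub_C_of_isUnit_sub (sub_ne_zero.mpr h).isUnit).pow
  have g : (X - C a)^(k+1) * (X - C b)^(k+1) * (X - C c)^(k+1) ∣ Φ :=
    ((cop c a hca).symm.mul_left (cop b c hbc)).mul_dvd ((cop a b hab).mul_dvd g1 g2) g3
  have hXk : (C N * X^k).natDegree ≤ 3*k+2 := (natDegree_C_mul_X_pow_le _ _).trans (by lia)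
  have hdeg : Φ.natDegree ≤ 3*k+2 :=
    (natDegree_sub_le_of_le (natDegree_sub_le_of_le (natDegree_sub_le_of_le hXk (dSd _ _ _))
      (dSd _ _ _)) (dSd _ _ _)).trans (by simp)
  have hz : Φ = 0 := by
    by_contra hne
    have := natDegree_le_of_dvd g hne
    rw [((hQm a).mul (hQm b)).natDegree_mul (hQm c), (hQm a).natDegree_mul (hQm b), hQ, hQ, hQ] at this
    lia
  have := congrArg (fun P => P.coeff (3*k+2)) hz
  simp only [hΦ, coeff_sub, cS, coeff_zero, coeff_C_mul_X_pow, show ¬ (3*k+2 = k) by lia,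
    if_false] at this
  linear_combination -this

lemma rho_eq {K : Type*} [Field K] (k : ℕ) (a b c : K) :
    rho k a b c = ∑ i ∈ range (k+1), ∑ j ∈ range (k+1),
      (k.choose (i+j) : K) * ((k+i).choose k) * ((k+j).choose k) * (-1)^(i+j) * a^(i+j) *
        (a-b)^(k-i) * (a-c)^(k-j) := by
  have hA : ∀ d, taylor a (A k k (C d) (C a - X)) =
      ∑ i ∈ range (k+1), C (((k+i).choose k : K) * (-1)^i * d^(k-i)) * X^i := by
    intro d
    unfold A
    rw [map_sum]
    apply sum_congr rfl
    intro i _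
    rw [taylor_mul, taylor_mul, taylor_pow, taylor_pow]
    have h1 : taylor a (C a - X) = - X := by simp
    have h2 : taylor a (((k+i).choose k : K[X])) = C ((k+i).choose k : K) := by
      rw [← C_eq_natCast, taylor_C]
    rw [h1, h2, taylor_C, neg_pow]
    simp only [C_mul, C_pow, C_neg, C_1]
    ring
  unfold rho
  rw [taylor_mul, taylor_mul, hA, hA, mul_assoc, sum_mul_sum, mul_sum, finsetSum_coeff]
  apply sum_congr rfl
  intro i _
  rw [mul_sum, finsetSum_coeff]
  apply sum_congr rfl
  intro j _
  rw [taylor_pow, taylor_X]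
  rw [show (X + C a)^k * (C (((k+i).choose k : K) * (-1)^i * (a-b)^(k-i)) * X^i *
    (C (((k+j).choose k : K) * (-1)^j * (a-c)^(k-j)) * X^j)) =
    C ((((k+i).choose k : K) * (-1)^i * (a-b)^(k-i)) * (((k+j).choose k : K) * (-1)^j * (a-c)^(k-j)))
     * ((X + C a)^k * X^(i+j)) by simp only [C_mul]; ring]
  rw [coeff_C_mul, coeff_mul_X_pow']
  split_ifs with h
  · rw [coeff_X_add_C_pow, Nat.choose_symm h, Nat.sub_sub_self h]
    ring
  · rw [Nat.choose_eq_zero_of_lt (show k < i + j by lia)]; simp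

def Ef {R : Type*} [CommRing R] (k : ℕ) (u x v w D2 D3 : R) : R :=
  u^(k+1) * ∑ i ∈ range (k+1), ∑ j ∈ range (k+1),
    (k.choose (i+j) : R) * ((k+i).choose k) * ((k+j).choose k) *
      (v*x)^i * (-(w*x))^j * D3^(k-i) * D2^(k-j)

lemma map_Ef {R S : Type*} [CommRing R] [CommRing S] (φ : R →+* S) (k : ℕ) (u x v w D2 D3 : R) :
    φ (Ef k u x v w D2 D3) = Ef k (φ u) (φ x) (φ v) (φ w) (φ D2) (φ D3) := by
  simp [Ef, map_sum]

lemma Ef_eq {K : Type*} [Field K] (k : ℕ) (u v w x y z : K) (hu : u ≠ 0) (hv : v ≠ 0) (hw : w ≠ 0) :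
    Ef k u x v w (w*x-u*z) (u*y-v*x) * (v*z-w*y)^(2*k+1) =
     (-1)^(k+1) * (u*v*w)^(3*k+1) *
      ((y/v-z/w)^(2*k+1) * rho k (x/u) (y/v) (z/w)) := by
  rw [rho_eq, Ef]
  simp only [mul_sum, sum_mul]
  apply sum_congr rfl
  intro i hi
  apply sum_congr rfl
  intro j hj
  obtain ⟨i', rfl⟩ : ∃ i', k = i + i' := ⟨k - i, by have := mem_range.mp hi; lia⟩
  obtain ⟨j', hj'⟩ : ∃ j', i + i' = j + j' := ⟨i + i' - j, by have := mem_range.mp hj; lia⟩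
  have e1 : i + i' - i = i' := by lia
  have e2 : i + i' - j = j' := by lia
  rw [e1, e2]
  rw [show x/u - y/v = -(u*y-v*x) / (u*v) by field_simp; ring,
    show x/u - z/w = (w*x-u*z) / (u*w) by field_simp; ,
    show y/v - z/w = -(v*z-w*y) / (v*w) by field_simp; ring]
  generalize u*y-v*x = D3
  generalize w*x-u*z = D2
  generalize v*z-w*y = D1
  have odd : Odd (2*(i+i')+1) := ⟨_, rfl⟩
  rw [div_pow, div_pow, div_pow, div_pow, odd.neg_pow, neg_pow D3]
  generalize ((i+i').choose (i+j) : K) = c1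
  generalize ((i+i'+i).choose (i+i') : K) = c2
  generalize ((i+i'+j).choose (i+i') : K) = c3
  have hs : ((-1:K))^(i+i'+1) * ((-1)^(i+j) * (-1)^i' * (-1)) = (-1)^j := by
    rw [← pow_add, ← pow_succ, ← pow_add]
    rw [show i+i'+1+(i+j+i'+1) = 2 * (i+i'+1) + j by ring, pow_add, pow_mul]; simp
  have hU : (u*v*w)^(3*(i+i')+1) = u^(i+i'+1) * v^i * w^j * (u^(i+j) * (u*v)^i' * (u*w)^j' * (v*w)^(2*(i+i')+1)) := by
    rw [show u^(i+i'+1) * v^i * w^j * (u^(i+j) * (u*v)^i' * (u*w)^j' * (v*w)^(2*(i+i')+1)) =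
      u^(i+i'+1 + (i + j) + i' + j') * v^(i + i' + (2*(i+i')+1)) * w^(j + j' + (2*(i+i')+1)) by ring,
      show i+i'+1 + (i + j) + i' + j' = 3*(i+i')+1 by lia, show i + i' + (2*(i+i')+1) = 3*(i+i')+1 by ring,
      ← hj', show i + i' + (2*(i+i')+1) = 3*(i+i')+1 by ring]
    ring
  rw [hU]
  rw [neg_pow (w*x), ← hs]
  field_simp
  ring

lemma ident_field {K : Type*} [Field K] (k : ℕ) (u v w x y z : K) (hu : u ≠ 0) (hv : v ≠ 0) (hw : w ≠ 0)
    (h1 : v*z-w*y ≠ 0) (h2 : w*x-u*z ≠ 0) (h3 : u*y-v*x ≠ 0) :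
    Ef k u x v w (w*x-u*z) (u*y-v*x) * (v*z-w*y)^(2*k+1) +
    Ef k v y w u (u*y-v*x) (v*z-w*y) * (w*x-u*z)^(2*k+1) +
    Ef k w z u v (v*z-w*y) (w*x-u*z) * (u*y-v*x)^(2*k+1) = 0 := by
  rw [Ef_eq k u v w x y z hu hv hw, Ef_eq k v w u y z x hv hw hu, Ef_eq k w u v z x y hw hu hv]
  have := res_sum k (x/u) (y/v) (z/w) (by
    intro h; apply h3; field_simp at h; linear_combination -h) (by
    intro h; apply h1; field_simp at h; linear_combination -h) (by
    intro h; apply h2; field_simp at h; linear_combination -h)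
  rw [show v*w*u = u*v*w by ring, show w*u*v = u*v*w by ring]
  linear_combination (-1)^(k+1) * (u*v*w)^(3*k+1) * this

lemma ident_domain {R : Type*} [CommRing R] [IsDomain R] (k : ℕ) (u v w x y z : R) (hu : u ≠ 0) (hv : v ≠ 0) (hw : w ≠ 0)
    (h1 : v*z-w*y ≠ 0) (h2 : w*x-u*z ≠ 0) (h3 : u*y-v*x ≠ 0) :
    Ef k u x v w (w*x-u*z) (u*y-v*x) * (v*z-w*y)^(2*k+1) +
    Ef k v y w u (u*y-v*x) (v*z-w*y) * (w*x-u*z)^(2*k+1) +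
    Ef k w z u v (v*z-w*y) (w*x-u*z) * (u*y-v*x)^(2*k+1) = 0 := by
  have inj : Function.Injective (algebraMap R (FractionRing R)) := IsFractionRing.injective _ _
  have ne : ∀ r : R, r ≠ 0 → algebraMap R (FractionRing R) r ≠ 0 := fun r h => by
    rwa [Ne, map_eq_zero_iff _ inj]
  apply inj
  simp only [map_add, map_mul, map_pow, map_Ef, map_sub, map_zero]
  apply ident_field k _ _ _ _ _ _ (ne _ hu) (ne _ hv) (ne _ hw)
  · simpa using ne _ h1
  · simpa using ne _ h2
  · simpa using ne _ h3

/-- reduction modulo `p` -/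
lemma Ef_mod {R : Type*} [CommRing R] (p e k : ℕ) (hp : p.Prime) (hk : k + 1 = p^e)
    (u x v w D2 D3 : R) : (p : R) ∣ Ef k u x v w D2 D3 - u^(k+1) * (D2*D3)^k := by
  have hdiv : ∀ i ∈ range (k+1), i ≠ 0 → p ∣ (k+i).choose k := by
    intro i hi h0
    have hi := mem_range.mp hi
    obtain ⟨i, rfl⟩ := Nat.exists_eq_succ_of_ne_zero h0
    -- (i+1) * C(k+i+1, k) = (k+1) * C(k+i+1,k+1)
    have h := Nat.choose_succ_right_eq (k+(i+1)) k
    rw [show k + (i+1) - k = i+1 by lia] at h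
    by_contra hnd
    have hc : Nat.Coprime (p^e) ((k+(i+1)).choose k) :=
      Nat.Coprime.pow_left _ ((Nat.Prime.coprime_iff_not_dvd hp).mpr hnd)
    have : p^e ∣ i + 1 := hc.dvd_of_dvd_mul_left (by rw [← h, hk]; exact Dvd.intro_left _ rfl)
    have := Nat.le_of_dvd (by lia) this
    lia
  unfold Ef
  rw [← mul_sub]
  apply Dvd.dvd.mul_left
  rw [sum_range_succ', sum_range_succ' (fun j => _) k]
  have hz : ((k.choose (0 + 0) : R) * ((k+0).choose k) * ((k+0).choose k) *
      (v*x)^0 * (-(w*x))^0 * D3^(k-0) * D2^(k-0)) = (D2*D3)^k := by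
    simp; ring
  rw [hz, ← add_assoc, add_sub_cancel_right]
  apply dvd_add
  · apply dvd_sum
    intro i hi
    apply dvd_sum
    intro j _
    have h := hdiv (i+1) (by have := mem_range.mp hi; exact mem_range.mpr (by lia)) (by lia)
    have h : (p : R) ∣ ((k+(i+1)).choose k : R) := by exact_mod_cast Nat.cast_dvd_cast h
    exact ((((((h.mul_left _).mul_right _).mul_right _).mul_right _).mul_right _).mul_right _)
  · apply dvd_sum
    intro i hi
    have h := hdiv (i+1) (by have := mem_range.mp hi; exact mem_range.mpr (by lia)) (by lia)
    have h : (p : R) ∣ ((k+(i+1)).choose k : R) := by exact_mod_cast Nat.cast_dvd_cast h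
    exact (((((h.mul_left _).mul_right _).mul_right _).mul_right _).mul_right _)

end Polynomial.Idt

namespace Alg

section gen
variable {S : Type} [CommRing S] [IsDomain S] [UniqueFactorizationMonoid S]

lemma prime_D1 : Prime (X 1 * X 5 - X 2 * X 4 : MvPolynomial (Fin 6) S) := by
  have hX : Irreducible (X 1 : MvPolynomial (Fin 6) S) := by
    have := irreducible_mul_X_add (1 : MvPolynomial (Fin 6) S) 0 1 one_ne_zero (by simp) (by simp)
      isRelPrime_one_left
    simpa using this
  have h := irreducible_mul_X_add (X 1 : MvPolynomial (Fin 6) S) (-(X 2 * X 4)) 5 (X_ne_zero _)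
    (by rw [vars_X]; decide)
    (by
      rw [vars_neg]
      intro h
      have := vars_mul _ _ h
      rw [vars_X, vars_X] at this
      revert this
      decide)
    (by
      rw [hX.isRelPrime_iff_not_dvd]
      intro h
      have := map_dvd (MvPolynomial.eval (![1,0,1,1,1,1] : Fin 6 → S)) h
      simp at this)
  rw [← sub_eq_add_neg] at h
  exact UniqueFactorizationMonoid.irreducible_iff_prime.mp h

lemma not_dvd : ¬ (X 1 * X 5 - X 2 * X 4 : MvPolynomial (Fin 6) S) ∣ X 2 * X 3 - X 0 * X 5 := by
  intro h
  have := map_dvd (MvPolynomial.eval (![0,0,1,1,0,0] : Fin 6 → S)) h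
  simp at this

lemma D2_ne : (X 2 * X 3 - X 0 * X 5 : MvPolynomial (Fin 6) S) ≠ 0 := by
  intro h; apply not_dvd (S := S); rw [h]; exact dvd_zero _

lemma D3_ne : (X 0 * X 4 - X 1 * X 3 : MvPolynomial (Fin 6) S) ≠ 0 := by
  intro h
  have := congrArg (MvPolynomial.eval (![1,0,0,0,1,0] : Fin 6 → S)) h
  simp at this

lemma reg (a b : ℕ) (x : MvPolynomial (Fin 6) S)
    (h : (X 1 * X 5 - X 2 * X 4)^b ∣ (X 2 * X 3 - X 0 * X 5)^a * x) :
    (X 1 * X 5 - X 2 * X 4)^b ∣ x :=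
  prime_D1.pow_dvd_of_dvd_mul_left _ (fun h' => not_dvd (prime_D1.dvd_of_dvd_pow h')) h

end gen

lemma hilbert_burch {A : Type*} [CommRing A] [IsDomain A] (u v w x y z b1 b2 b3 : A)
    (h1 : v*z-w*y ≠ 0)
    (H : ∀ s, v*z-w*y ∣ (w*x-u*z) * s → v*z-w*y ∣ s)
    (h : b1 * (v*z-w*y) + b2 * (w*x-u*z) + b3 * (u*y-v*x) = 0) :
    ∃ c d, b3 = c * w + d * z := by
  obtain ⟨α, hα⟩ := H (b2*z-b3*y) ⟨b3*x-b1*z, by linear_combination z * h⟩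
  obtain ⟨β, hβ⟩ := H (b2*w-b3*v) ⟨b3*u-b1*w, by linear_combination w * h⟩
  refine ⟨α, -β, ?_⟩
  apply mul_left_cancel₀ h1
  linear_combination w * hα - z * hβ

lemma mem_pf {R A : Type*} [CommRing R] [CommRing A] (φ : R →+* A) (hφ : Function.Surjective φ)
    (p : R) (hker : ∀ r, φ r = 0 ↔ p ∣ r) (f x : R) :
    x ∈ Ideal.span {p} ⊔ Ideal.span {f} ↔ φ f ∣ φ x := by
  have hp : φ p = 0 := (hker p).mpr dvd_rfl
  constructor
  · intro h
    obtain ⟨y, hy, z, hz, rfl⟩ := Submodule.mem_sup.mp h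
    obtain ⟨w, rfl⟩ := Ideal.mem_span_singleton.mp hz
    obtain ⟨w', rfl⟩ := Ideal.mem_span_singleton.mp hy
    simp [hp]
  · rintro ⟨c, hc⟩
    obtain ⟨c, rfl⟩ := hφ c
    have : p ∣ x - f * c := by rw [← hker]; simp [hc]
    have e : x = (x - f * c) + f * c := by ring
    rw [e]
    exact Submodule.add_mem_sup (Ideal.mem_span_singleton.mpr this)
      (Ideal.mem_span_singleton.mpr (dvd_mul_right _ _))

section main
variable (p : ℕ) 

noncomputable abbrev φ : MvPolynomial (Fin 6) ℤ →+* MvPolynomial (Fin 6) (ZMod p) :=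
  MvPolynomial.map (Int.castRingHom (ZMod p))

lemma φ_surj : Function.Surjective (φ p) :=
  MvPolynomial.map_surjective _ (ZMod.ringHom_surjective _)

lemma φ_ker (r : MvPolynomial (Fin 6) ℤ) : φ p r = 0 ↔ (p : MvPolynomial (Fin 6) ℤ) ∣ r := by
  rw [← C_dvd_iff_zmod]; simp

lemma φ1 : φ p Δ1 = X 1 * X 5 - X 2 * X 4 := by simp [Δ1, V, W, Yy, Zz]
lemma φ2 : φ p Δ2 = X 2 * X 3 - X 0 * X 5 := by simp [Δ2, U, W, Xx, Zz]
lemma φ3 : φ p Δ3 = X 0 * X 4 - X 1 * X 3 := by simp [Δ3, U, V, Xx, Yy]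

lemma reg_f (hp : p.Prime) (a : ℕ) (x : MvPolynomial (Fin 6) ℤ)
    (h : Δ1^a * x ∈ Ideal.span {(p : MvPolynomial (Fin 6) ℤ)}) :
    x ∈ Ideal.span {(p : MvPolynomial (Fin 6) ℤ)} := by
  have := Fact.mk hp
  rw [Ideal.mem_span_singleton, ← φ_ker] at h ⊢
  rw [map_mul, map_pow, φ1] at h
  exact (mul_eq_zero.mp h).resolve_left (pow_ne_zero _ prime_D1.ne_zero)

lemma reg_g (hp : p.Prime) (a b : ℕ) (x : MvPolynomial (Fin 6) ℤ)
    (h : Δ2^a * x ∈ Ideal.span {(p : MvPolynomial (Fin 6) ℤ)} ⊔ Ideal.span {Δ1^b}) :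
    x ∈ Ideal.span {(p : MvPolynomial (Fin 6) ℤ)} ⊔ Ideal.span {Δ1^b} := by
  have := Fact.mk hp
  rw [mem_pf (φ p) (φ_surj p) _ (φ_ker p)] at h ⊢
  simp only [map_mul, map_pow, φ1, φ2] at h ⊢
  exact reg _ _ _ h

lemma reg_tf (a : ℕ) (x : MvPolynomial (Fin 6) ℤ) (h : Δ1^a * x = 0) : x = 0 :=
  (mul_eq_zero.mp h).resolve_left (pow_ne_zero _ (prime_D1 (S := ℤ)).ne_zero)

lemma reg_tg (a b : ℕ) (x : MvPolynomial (Fin 6) ℤ)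
    (h : Δ2^a * x ∈ Ideal.span {Δ1^b}) : x ∈ Ideal.span {Δ1^b} := by
  rw [Ideal.mem_span_singleton] at h ⊢
  exact reg _ _ _ h

lemma key3 (hp : p.Prime) (e k : ℕ) (hk : k + 1 = p^e) (b : MvPolynomial (Fin 6) ℤ)
    (h : Δ3^(k+1) * b ∈ Ideal.span {(p : MvPolynomial (Fin 6) ℤ)} ⊔ Ideal.span {Δ1^(k+1)} ⊔
      Ideal.span {Δ2^(k+1)}) :
    ∃ b', Δ3^(2*k+1) * b' ∈ Ideal.span {Δ1^(2*k+1)} ⊔ Ideal.span {Δ2^(2*k+1)} ∧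
      Δ1^k * Δ2^k * b - b' ∈ Ideal.span {(p : MvPolynomial (Fin 6) ℤ)} := by
  have := Fact.mk hp
  have d1 : Δ1 = V*Zz - W*Yy := rfl
  have d2 : Δ2 = W*Xx - U*Zz := rfl
  have d3 : Δ3 = U*Yy - V*Xx := rfl
  obtain ⟨y, hy, z, hz, hs⟩ := Submodule.mem_sup.mp h
  obtain ⟨t, rfl⟩ := Ideal.mem_span_singleton.mp hz
  obtain ⟨s, hs'⟩ := (mem_pf (φ p) (φ_surj p) _ (φ_ker p) _ _).mp hy
  have h' := congrArg (φ p) hs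
  rw [map_add, hs'] at h'
  simp only [map_mul, map_pow, φ1, φ2, φ3] at h' 
  have hb : ∃ c d, φ p b = c * (X 2)^(k+1) + d * (X 5)^(k+1) := by
    have e1 : (X 1 * X 5 - X 2 * X 4 : MvPolynomial (Fin 6) (ZMod p))^(k+1) =
      X 1^(k+1) * X 5^(k+1) - X 2^(k+1) * X 4^(k+1) := by
      rw [hk, sub_pow_char_pow, mul_pow, mul_pow]
    have e2 : (X 2 * X 3 - X 0 * X 5 : MvPolynomial (Fin 6) (ZMod p))^(k+1) =
      X 2^(k+1) * X 3^(k+1) - X 0^(k+1) * X 5^(k+1) := by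
      rw [hk, sub_pow_char_pow, mul_pow, mul_pow]
    have e3 : (X 0 * X 4 - X 1 * X 3 : MvPolynomial (Fin 6) (ZMod p))^(k+1) =
      X 0^(k+1) * X 4^(k+1) - X 1^(k+1) * X 3^(k+1) := by
      rw [hk, sub_pow_char_pow, mul_pow, mul_pow]
    apply hilbert_burch (X 0^(k+1)) (X 1^(k+1)) (X 2^(k+1)) (X 3^(k+1)) (X 4^(k+1)) (X 5^(k+1))
      (-s) (-(φ p t)) (φ p b)
    · rw [← e1]; exact pow_ne_zero _ prime_D1.ne_zero
    · intro s; rw [← e1, ← e2]; exact reg _ _ _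
    · rw [← e1, ← e2, ← e3]; linear_combination -h'
  obtain ⟨c, d, hb⟩ := hb
  obtain ⟨c, rfl⟩ := φ_surj p c
  obtain ⟨d, rfl⟩ := φ_surj p d
  have hb : (p : MvPolynomial (Fin 6) ℤ) ∣ b - (c * W^(k+1) + d * Zz^(k+1)) := by
    rw [← φ_ker, map_sub, hb]
    simp [W, Zz]
  have n1 : V*Zz - W*Yy ≠ 0 := (prime_D1 (S := ℤ)).ne_zero
  have n2 : W*Xx - U*Zz ≠ 0 := D2_ne (S := ℤ)
  have n3 : U*Yy - V*Xx ≠ 0 := D3_ne (S := ℤ)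
  have i1 := Polynomial.Idt.ident_domain k U V W Xx Yy Zz (X_ne_zero _) (X_ne_zero _) (X_ne_zero _) n1 n2 n3
  have i2 := Polynomial.Idt.ident_domain k Xx Yy Zz U V W (X_ne_zero _) (X_ne_zero _) (X_ne_zero _)
    (by intro h; apply n1; linear_combination -h) (by intro h; apply n2; linear_combination -h)
    (by intro h; apply n3; linear_combination -h)
  have m1 := Polynomial.Idt.Ef_mod p e k hp hk W Zz U V Δ1 Δ2
  have m2 := Polynomial.Idt.Ef_mod p e k hp hk Zz W Xx Yy (-Δ1) (-Δ2)
  rw [neg_mul_neg] at m2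
  rw [show Yy*W - Zz*V = -Δ1 by rw [d1]; ring, show Zz*U - Xx*W = -Δ2 by rw [d2]; ring,
    show Xx*V - Yy*U = -Δ3 by rw [d3]; ring] at i2
  rw [← d1, ← d2, ← d3] at i1
  have odd : Odd (2*k+1) := ⟨k, rfl⟩
  simp only [odd.neg_pow] at i2
  refine ⟨c * Polynomial.Idt.Ef k W Zz U V Δ1 Δ2 + d * Polynomial.Idt.Ef k Zz W Xx Yy (-Δ1) (-Δ2), ?_, ?_⟩
  · rw [Submodule.mem_sup]
    generalize Polynomial.Idt.Ef k W Zz U V Δ1 Δ2 = E3 at *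
    generalize Polynomial.Idt.Ef k Zz W Xx Yy (-Δ1) (-Δ2) = E3' at *
    refine ⟨_, Ideal.mem_span_singleton.mpr (dvd_mul_right _
      (-(c * Polynomial.Idt.Ef k U Xx V W Δ2 Δ3 + d * Polynomial.Idt.Ef k Xx U Yy Zz (-Δ2) (-Δ3)))),
      _, Ideal.mem_span_singleton.mpr (dvd_mul_right _
      (-(c * Polynomial.Idt.Ef k V Yy W U Δ3 Δ1 + d * Polynomial.Idt.Ef k Yy V Zz Xx (-Δ3) (-Δ1)))), ?_⟩
    linear_combination -c * i1 + d * i2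
  · rw [Ideal.mem_span_singleton]
    have := dvd_sub (dvd_sub (hb.mul_left (Δ1^k*Δ2^k)) (m1.mul_left c)) (m2.mul_left d)
    convert this using 1
    ring

lemma I23_pow (N : ℕ) : I23^(N+(N+N)) ≤ Ideal.span {Δ1^N} ⊔ (Ideal.span {Δ2^N} ⊔ Ideal.span {Δ3^N}) := by
  have : I23 = Ideal.span {Δ1} ⊔ (Ideal.span {Δ2} ⊔ Ideal.span {Δ3}) := by
    rw [I23, Ideal.span_insert, Ideal.span_insert]
  rw [this]
  refine Ideal.sup_pow_add_le_pow_sup_pow.trans (sup_le_sup ?_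
    (Ideal.sup_pow_add_le_pow_sup_pow.trans (sup_le_sup ?_ ?_))) <;>
  rw [Ideal.span_singleton_pow]

lemma mem1 : Δ1 ∈ I23 := Ideal.subset_span (by simp)
lemma mem2 : Δ2 ∈ I23 := Ideal.subset_span (by simp)
lemma mem3 : Δ3 ∈ I23 := Ideal.subset_span (by simp)

/-- transition maps kill the `p`-torsion -/
lemma level (hp : p.Prime) (t : ℕ) : ∃ (t' : ℕ) (_ : t ≤ t') (hJ : I23^t' ≤ I23^t),
    ∀ (m : CategoryTheory.Abelian.Ext.{0} (ModuleCat.of (MvPolynomial (Fin 6) ℤ) (MvPolynomial (Fin 6) ℤ ⧸ I23^t))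
      (ModuleCat.of (MvPolynomial (Fin 6) ℤ) (MvPolynomial (Fin 6) ℤ)) 3),
      (p : MvPolynomial (Fin 6) ℤ) • m = 0 →
      (CategoryTheory.Abelian.Ext.mk₀ (ModuleCat.ofHom (Submodule.mapQ (I23^t') (I23^t) LinearMap.id hJ))).comp m
      (zero_add 3) = 0 := by
  obtain ⟨k, hk⟩ : ∃ k, k + 1 = p^t := ⟨p^t - 1, by have := Nat.pow_pos (n := t) hp.pos; lia⟩
  have htk : t ≤ k+1 := hk ▸ (Nat.lt_pow_self hp.one_lt).le
  set N := 2*k+1 with hN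
  refine ⟨max t (N+(N+N)), le_max_left _ _, Ideal.pow_le_pow_right (le_max_left _ _), ?_⟩
  have hpow : I23^(max t (N+(N+N))) ≤ _ := (Ideal.pow_le_pow_right (le_max_right _ _)).trans (I23_pow N)
  have hlev : ∀ r ∈ I23, r^(k+1) ∈ I23^t := fun r hr =>
    Ideal.pow_le_pow_right htk (Ideal.pow_mem_pow hr _)
  intro m hm
  have q1 : Δ1^(k+1) * Δ1^k = Δ1^N := by rw [← pow_add, hN]; congr 1; ring
  have q2 : Δ2^(k+1) * Δ2^k = Δ2^N := by rw [← pow_add, hN]; congr 1; ring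
  refine ext_ideal (f := Δ1^(k+1)) (g := Δ2^(k+1)) (f1 := Δ1^k) (g1 := Δ2^k) _ _
    (hlev _ mem1) (hlev _ mem2) ?_ (reg_f p hp _) (reg_g p hp _ _) ?_ ?_ ?_ ?_ ?_ m hm
  · intro x hx
    exact (mul_eq_zero.mp hx).resolve_left (Nat.cast_ne_zero.mpr hp.ne_zero)
  · rw [q1]; exact reg_f p hp _
  · rw [q1, q2]; exact reg_g p hp _ _
  · rw [q1]; exact reg_tf _
  · rw [q1, q2]; exact reg_tg _ _
  · rw [q1, q2]
    intro b hb
    obtain ⟨b', h1, h2⟩ := key3 p hp t k hk b (hb _ (hlev _ mem3))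
    refine ⟨b', ?_, h2⟩
    intro j hj
    obtain ⟨j1, hj1, j', hj', rfl⟩ := Submodule.mem_sup.mp (hpow hj)
    obtain ⟨j2, hj2, j3, hj3, rfl⟩ := Submodule.mem_sup.mp hj'
    obtain ⟨j3, rfl⟩ := Ideal.mem_span_singleton.mp hj3
    rw [show (j1 + (j2 + Δ3^N*j3)) * b' = j1 * b' + j2 * b' + j3 * (Δ3^N * b') by ring]
    refine Ideal.add_mem _ (Ideal.add_mem _ (Ideal.mem_sup_left (Ideal.mul_mem_right _ _ hj1))
      (Ideal.mem_sup_right (Ideal.mul_mem_right _ _ hj2))) (Ideal.mul_mem_left _ _ h1)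
end main
end Alg

section Final
open CategoryTheory Opposite Limits

lemma colim_torsion {R : Type} [CommRing R] {J : Type} [SmallCategory J] [IsFiltered J]
    (D : J ⥤ ModuleCat.{0} R ⥤ ModuleCat.{0} R) [HasColimit D] (Y : ModuleCat.{0} R) (r : R)
    (H : ∀ j, ∃ (k : J) (f : j ⟶ k), ∀ m : (D.obj j).obj Y, r • m = 0 → (D.map f).app Y m = 0)
    (x : (colimit D).obj Y) (hx : r • x = 0) : x = 0 := by
  let hc : IsColimit (((evaluation _ _).obj Y).mapCocone (colimit.cocone D)) :=
    isColimitOfPreserves _ (colimit.isColimit D)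
  obtain ⟨j, y, hy⟩ := Concrete.isColimit_exists_rep _ hc x
  subst hy
  have h0 : (((evaluation _ _).obj Y).mapCocone (colimit.cocone D)).ι.app j (r • y) =
      (((evaluation _ _).obj Y).mapCocone (colimit.cocone D)).ι.app j 0 := by
    rw [map_smul, map_zero]; exact hx
  obtain ⟨k, f, g, hfg⟩ := Concrete.isColimit_exists_of_rep_eq _ hc _ _ h0
  rw [map_zero, map_smul] at hfg
  obtain ⟨l, h, hl⟩ := H k
  have h1 := hl _ hfg
  have h2 : (((evaluation _ _).obj Y).mapCocone (colimit.cocone D)).ι.app j y =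
      (((evaluation _ _).obj Y).mapCocone (colimit.cocone D)).ι.app j 0 := by
    apply Concrete.isColimit_rep_eq_of_exists
    refine ⟨l, f ≫ h, f ≫ h, ?_⟩
    rw [map_zero, Functor.map_comp, ModuleCat.comp_apply]
    exact h1
  rw [map_zero] at h2
  exact h2

lemma main_zero (p : ℕ) (hp : p.Prime) (m : (localCohomology I23 3).obj
          (ModuleCat.of (MvPolynomial (Fin 6) ℤ) (MvPolynomial (Fin 6) ℤ)))
    (hm : (p : MvPolynomial (Fin 6) ℤ) • m = 0) : m = 0 := by
  have := localCohomology.hasColimitDiagram.{0, 0} (localCohomology.idealPowersDiagram I23) 3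
  refine colim_torsion (localCohomology.diagram (localCohomology.idealPowersDiagram I23) 3) _ _ ?_ m hm
  intro j
  obtain ⟨t', ht, hJ, H⟩ := Alg.level p hp j.unop.unop
  refine ⟨op (op t'), (homOfLE ht).op.op, ?_⟩
  intro m hm
  exact ext_transfer (ModuleCat.ofHom (Submodule.mapQ (I23^t') (I23^j.unop.unop) LinearMap.id hJ)) 2
    (p : MvPolynomial (Fin 6) ℤ) H m hm

end Final

/-- For every prime `p`, multiplication by `p` is injective on `H³_I(R)`, i.e. `H³_I(R)` has
no `p`-torsion for any prime `p`. -/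
theorem third_local_cohomology_no_p_torsion (p : ℕ) (hp : p.Prime) :
    Function.Injective
      (fun m : (localCohomology I23 3).obj
          (ModuleCat.of (MvPolynomial (Fin 6) ℤ) (MvPolynomial (Fin 6) ℤ)) =>
        (p : ℤ) • m) := by
  intro m n h
  rw [← sub_eq_zero]
  apply main_zero p hp
  have h : (p : ℤ) • (m - n) = 0 := by
    rw [smul_sub, sub_eq_zero]; exact h
  rw [natCast_zsmul] at h
  rw [Nat.cast_smul_eq_nsmul]
  exact h
end
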